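/- Let u_p be a least energy solution of the Finsler Lane-Emden problem -Q_N u = u^p in Ω, u > 0 in Ω, u = 0 on ∂Ω. Then 1 ≤ limsup_{p→∞} ‖u_p‖_{L^∞(Ω)} ≤ e^{(N-1)/N}. -/

import Mathlib

open MeasureTheory Filter Real Set
open scoped RealInnerProductSpace Topology NNReal

noncomputable section

abbrev Euc (N : ℕ) := EuclideanSpace ℝ (Fin N)

/-- `H` is a norm on `ℝ^N`: convex, nonnegative, vanishing exactly at `0`,
and absolutely homogeneous. -/
def IsFinslerNorm (N : ℕ) (H : Euc N → ℝ) : Prop :=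
  ConvexOn ℝ Set.univ H ∧
  (∀ ξ, 0 ≤ H ξ) ∧
  (∀ ξ, H ξ = 0 ↔ ξ = 0) ∧
  (∀ (t : ℝ) (ξ : Euc N), H (t • ξ) = |t| * H ξ)

/-- Regularity assumptions: `H ∈ C²(ℝ^N \ {0})`, `H^N ∈ C¹(ℝ^N)`, and the Hessian of
`H^N` is positive definite away from the origin. -/
def FinslerRegular (N : ℕ) (H : Euc N → ℝ) : Prop :=
  ContDiffOn ℝ 2 H {(0 : Euc N)}ᶜ ∧
  ContDiff ℝ 1 (fun ξ => H ξ ^ N) ∧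
  ∀ ξ : Euc N, ξ ≠ 0 → ∀ v : Euc N, v ≠ 0 →
    0 < iteratedFDeriv ℝ 2 (fun ξ => H ξ ^ N) ξ ![v, v]

/-- The dual norm `H⁰(x) = sup_{ξ ≠ 0} ⟪x, ξ⟫ / H(ξ)`. -/
def dualNorm {N : ℕ} (H : Euc N → ℝ) (x : Euc N) : ℝ :=
  sSup {r : ℝ | ∃ ξ : Euc N, ξ ≠ 0 ∧ r = ⟪x, ξ⟫ / H ξ}

/-- `κ_N`, the volume of the Wulff ball `{H⁰ < 1}`. -/
def wulffVol (N : ℕ) (H : Euc N → ℝ) : ℝ :=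
  (volume {x : Euc N | dualNorm H x < 1}).toReal

/-- `β_N = N (N κ_N)^{1/(N-1)}`. -/
def betaN (N : ℕ) (H : Euc N → ℝ) : ℝ :=
  N * (N * wulffVol N H) ^ ((1 : ℝ) / ((N : ℝ) - 1))

/-- `u` is a weak solution of `-Q_N u = g` on the open set `U`:
`∫_U H(∇u)^{N-1} ⟪∇H(∇u), ∇φ⟫ = ∫_U g φ` for all test functions `φ`. -/
def IsWeakSolution (N : ℕ) (H : Euc N → ℝ) (U : Set (Euc N)) (u g : Euc N → ℝ) : Prop :=
  ∀ φ : Euc N → ℝ, ContDiff ℝ (⊤ : ℕ∞) φ → HasCompactSupport φ → tsupport φ ⊆ U →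
    (∫ x in U, H (gradient u x) ^ (N - 1) * ⟪gradient H (gradient u x), gradient φ x⟫)
      = ∫ x in U, g x * φ x

/-- `C_p`, the infimum of `∫_Ω H(∇u)^N` over test functions normalized in `L^{p+1}`. -/
def energyInf (N : ℕ) (H : Euc N → ℝ) (Ω : Set (Euc N)) (p : ℝ) : ℝ :=
  sInf {c : ℝ | ∃ u : Euc N → ℝ, ContDiff ℝ (⊤ : ℕ∞) u ∧ HasCompactSupport u ∧
    tsupport u ⊆ Ω ∧ (∫ x in Ω, |u x| ^ (p + 1)) = 1 ∧
    c = ∫ x in Ω, H (gradient u x) ^ N}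

/-- A least energy solution of the Finsler Lane–Emden problem on `Ω` with exponent `p`. -/
def IsLeastEnergySolution (N : ℕ) (H : Euc N → ℝ) (Ω : Set (Euc N)) (p : ℝ)
    (u : Euc N → ℝ) : Prop :=
  ContDiffOn ℝ 1 u (closure Ω) ∧
  (∀ x ∈ Ω, 0 < u x) ∧
  (∀ x ∈ frontier Ω, u x = 0) ∧
  IsWeakSolution N H Ω u (fun x => u x ^ p) ∧
  (∫ x in Ω, H (gradient u x) ^ N)
    = energyInf N H Ω p * (∫ x in Ω, u x ^ (p + 1)) ^ ((N : ℝ) / (p + 1))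

/-- The blow-up set of a sequence of functions `v n` on `Ω`. -/
def BlowUpSet {N : ℕ} (Ω : Set (Euc N)) (v : ℕ → Euc N → ℝ) : Set (Euc N) :=
  {x | x ∈ closure Ω ∧ ∃ σ : ℕ → ℕ, StrictMono σ ∧ ∃ xs : ℕ → Euc N,
    (∀ n, xs n ∈ Ω) ∧ Tendsto xs atTop (𝓝 x) ∧
    Tendsto (fun n => v (σ n) (xs n)) atTop atTop}

/-! ### Elementary properties of a Finsler norm -/

section FinslerNorm

variable {N : ℕ} {H : Euc N → ℝ}

lemma IsFinslerNorm.nonneg (h : IsFinslerNorm N H) (ξ : Euc N) : 0 ≤ H ξ := h.2.1 ξ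

lemma IsFinslerNorm.map_smul (h : IsFinslerNorm N H) (t : ℝ) (ξ : Euc N) :
    H (t • ξ) = |t| * H ξ := h.2.2.2 t ξ

lemma IsFinslerNorm.map_zero (h : IsFinslerNorm N H) : H 0 = 0 := (h.2.2.1 0).2 rfl

lemma IsFinslerNorm.pos (h : IsFinslerNorm N H) {ξ : Euc N} (hξ : ξ ≠ 0) : 0 < H ξ :=
  lt_of_le_of_ne (h.nonneg ξ) fun h0 => hξ ((h.2.2.1 ξ).1 h0.symm)

lemma IsFinslerNorm.add_le (h : IsFinslerNorm N H) (ξ η : Euc N) : H (ξ + η) ≤ H ξ + H η := by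
  have := h.1.2 (mem_univ ((2 : ℝ) • ξ)) (mem_univ ((2 : ℝ) • η))
    (by norm_num : (0 : ℝ) ≤ 1 / 2) (by norm_num : (0 : ℝ) ≤ 1 / 2) (by norm_num)
  simp only [smul_smul, h.map_smul, smul_eq_mul] at this
  norm_num at this
  linarith

lemma IsFinslerNorm.continuous (h : IsFinslerNorm N H) : Continuous H := by
  have := h.1.continuousOn isOpen_univ
  exact continuousOn_univ.1 this

lemma IsFinslerNorm.exists_le (h : IsFinslerNorm N H) :
    ∃ C : ℝ, 0 < C ∧ ∀ ξ, H ξ ≤ C * ‖ξ‖ := by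
  obtain ⟨C, hC⟩ := (isCompact_closedBall (0 : Euc N) 1).exists_bound_of_continuousOn
    h.continuous.continuousOn
  refine ⟨max C 1, by positivity, fun ξ => ?_⟩
  rcases eq_or_ne ξ 0 with rfl | hξ
  · simp [h.map_zero]
  · have hn : 0 < ‖ξ‖ := norm_pos_iff.2 hξ
    have h1 : H ((‖ξ‖⁻¹) • ξ) ≤ C := by
      refine (le_abs_self _).trans (hC _ ?_)
      simp [norm_smul, hn.ne']
    rw [h.map_smul, abs_of_pos (inv_pos.2 hn), inv_mul_le_iff₀ hn] at h1
    nlinarith [le_max_left C 1]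

lemma IsFinslerNorm.exists_ge (h : IsFinslerNorm N H) :
    ∃ c : ℝ, 0 < c ∧ ∀ ξ, c * ‖ξ‖ ≤ H ξ := by
  rcases (Metric.sphere (0 : Euc N) 1).eq_empty_or_nonempty with he | hne
  · refine ⟨1, one_pos, fun ξ => ?_⟩
    rcases eq_or_ne ξ 0 with rfl | hξ
    · simp [h.map_zero]
    · exfalso
      have : (‖ξ‖⁻¹) • ξ ∈ Metric.sphere (0 : Euc N) 1 := by
        simp [norm_smul, hξ]
      rw [he] at this
      exact this
  · obtain ⟨ξ₀, h0, hmin⟩ := (isCompact_sphere (0 : Euc N) 1).exists_isMinOn hne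
      h.continuous.continuousOn
    have hξ0 : ξ₀ ≠ 0 := by
      rintro rfl
      simp at h0
    refine ⟨H ξ₀, h.pos hξ0, fun ξ => ?_⟩
    rcases eq_or_ne ξ 0 with rfl | hξ
    · simp [h.map_zero]
    · have hn : 0 < ‖ξ‖ := norm_pos_iff.2 hξ
      have h1 : H ξ₀ ≤ H ((‖ξ‖⁻¹) • ξ) := hmin (by simp [norm_smul, hξ])
      rw [h.map_smul, abs_of_pos (inv_pos.2 hn), le_inv_mul_iff₀ hn] at h1
      linarith

lemma IsFinslerNorm.exists_lipschitz (h : IsFinslerNorm N H) :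
    ∃ C : ℝ≥0, LipschitzWith C H := by
  obtain ⟨C, hC, hle⟩ := h.exists_le
  refine ⟨⟨C, hC.le⟩, LipschitzWith.of_le_add_mul _ fun x y => ?_⟩
  have h1 := h.add_le y (x - y)
  rw [add_sub_cancel] at h1
  have h2 := hle (x - y)
  rw [dist_eq_norm]
  change H x ≤ H y + C * ‖x - y‖
  linarith

lemma norm_gradient_eq {f : Euc N → ℝ} (x : Euc N) : ‖gradient f x‖ = ‖fderiv ℝ f x‖ := by
  simp [gradient]

lemma IsFinslerNorm.inner_gradient_self (h : IsFinslerNorm N H) (hreg : FinslerRegular N H)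
    {ξ : Euc N} (hξ : ξ ≠ 0) : ⟪gradient H ξ, ξ⟫ = H ξ := by
  have hd : DifferentiableAt ℝ H ξ :=
    (hreg.1.contDiffAt (isOpen_compl_singleton.mem_nhds hξ)).differentiableAt (by norm_num)
  have h1 : HasDerivAt (fun t : ℝ => H ((1 + t) • ξ)) (fderiv ℝ H ξ ξ) 0 := by
    have hd' : HasFDerivAt H (fderiv ℝ H ξ) ((1 + (0 : ℝ)) • ξ) := by simpa using hd.hasFDerivAt
    have hl : HasDerivAt (fun t : ℝ => (1 + t) • ξ) ξ 0 := by
      simpa using ((hasDerivAt_id (0 : ℝ)).const_add 1).smul_const ξ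
    exact hd'.comp_hasDerivAt (0 : ℝ) hl
  have h2 : HasDerivAt (fun t : ℝ => H ((1 + t) • ξ)) (H ξ) 0 := by
    have hl : HasDerivAt (fun t : ℝ => (1 + t) * H ξ) (H ξ) 0 := by
      simpa using ((hasDerivAt_id (0 : ℝ)).const_add 1).mul_const (H ξ)
    refine hl.congr_of_eventuallyEq ?_
    filter_upwards [Ioi_mem_nhds (show (-1 : ℝ) < 0 by norm_num)] with t ht
    rw [h.map_smul, abs_of_pos (by linarith [mem_Ioi.1 ht])]
  rw [inner_gradient_left]
  exact h1.unique h2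

lemma measurable_gradient {f : Euc N → ℝ} : Measurable (gradient f) :=
  (LinearIsometryEquiv.continuous _).measurable.comp (measurable_fderiv ℝ f)

end FinslerNorm

/-- Jensen's inequality for `x ↦ x ^ N` with unnormalised weights. -/
lemma add_pow_le_weighted {N : ℕ} (hN : 1 ≤ N) {a b g₁ g₂ : ℝ} (ha : 0 ≤ a) (hb : 0 ≤ b)
    (h₁ : 0 < g₁) (h₂ : 0 < g₂) :
    (a + b) ^ N ≤ (g₁ + g₂) ^ (N - 1) * (a ^ N / g₁ ^ (N - 1) + b ^ N / g₂ ^ (N - 1)) := by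
  obtain ⟨n, rfl⟩ := Nat.exists_eq_add_of_le' hN
  have hG : 0 < g₁ + g₂ := by positivity
  have h := (convexOn_pow (𝕜 := ℝ) (n + 1)).2
    (mem_Ici.2 (show 0 ≤ a * (g₁ + g₂) / g₁ by positivity))
    (mem_Ici.2 (show 0 ≤ b * (g₁ + g₂) / g₂ by positivity))
    (show 0 ≤ g₁ / (g₁ + g₂) by positivity) (show 0 ≤ g₂ / (g₁ + g₂) by positivity)
    (by field_simp)
  simp only [smul_eq_mul] at h
  have e1 : g₁ / (g₁ + g₂) * (a * (g₁ + g₂) / g₁) + g₂ / (g₁ + g₂) * (b * (g₁ + g₂) / g₂)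
      = a + b := by field_simp
  rw [e1] at h
  refine h.trans (le_of_eq ?_)
  simp only [Nat.add_sub_cancel, div_pow, mul_pow]
  field_simp
  ring

/-! ### Calculus rules for the gradient -/

section Gradient

variable {N : ℕ}

lemma gradient_comp_real {F : ℝ → ℝ} {F' : ℝ} {w : Euc N → ℝ} {x : Euc N}
    (hF : HasDerivAt F F' (w x)) (hw : DifferentiableAt ℝ w x) :
    gradient (fun y => F (w y)) x = F' • gradient w x := by
  have : HasFDerivAt (fun y => F (w y)) (F' • fderiv ℝ w x) x :=
    hF.comp_hasFDerivAt x hw.hasFDerivAt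
  simp [gradient, this.fderiv]

lemma gradient_const_mul {w : Euc N → ℝ} (c : ℝ) {x : Euc N} (hw : DifferentiableAt ℝ w x) :
    gradient (fun y => c * w y) x = c • gradient w x :=
  gradient_comp_real (F := fun r => c * r) (by simpa using (hasDerivAt_id (w x)).const_mul c) hw

lemma gradient_mul {v w : Euc N → ℝ} {x : Euc N} (hv : DifferentiableAt ℝ v x)
    (hw : DifferentiableAt ℝ w x) :
    gradient (fun y => v y * w y) x = v x • gradient w x + w x • gradient v x := by
  simp [gradient, fderiv_fun_mul hv hw]

lemma gradient_sum {ι : Type*} (s : Finset ι) {w : ι → Euc N → ℝ} {x : Euc N}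
    (hw : ∀ i ∈ s, DifferentiableAt ℝ (w i) x) :
    gradient (fun y => ∑ i ∈ s, w i y) x = ∑ i ∈ s, gradient (w i) x := by
  simp [gradient, fderiv_fun_sum hw]

lemma gradient_comp_affine {w : Euc N → ℝ} (k : ℝ) (a : Euc N) {x : Euc N}
    (hw : Differentiable ℝ w) :
    gradient (fun y => w (k • y + a)) x = k • gradient w (k • x + a) := by
  have h1 : HasFDerivAt (fun y : Euc N => k • y + a) (k • ContinuousLinearMap.id ℝ (Euc N)) x :=
    ((hasFDerivAt_id x).const_smul k).add_const a
  have := (hw (k • x + a)).hasFDerivAt.comp x h1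
  have h2 : fderiv ℝ (fun y => w (k • y + a)) x = k • fderiv ℝ w (k • x + a) := by
    rw [show (fun y => w (k • y + a)) = w ∘ fun y => k • y + a from rfl, this.fderiv]
    ext v
    simp
  simp [gradient, h2]

lemma continuous_gradient {w : Euc N → ℝ} (hw : ContDiff ℝ 1 w) : Continuous (gradient w) :=
  (LinearIsometryEquiv.continuous _).comp (hw.continuous_fderiv one_ne_zero)

lemma gradient_eq_zero_of_notMem_tsupport {w : Euc N → ℝ} {x : Euc N} (hx : x ∉ tsupport w) :
    gradient w x = 0 := by
  have h := (notMem_tsupport_iff_eventuallyEq.1 hx)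
  rw [h.gradient_eq]
  exact gradient_fun_const x (0 : ℝ)

lemma hasCompactSupport_gradient {w : Euc N → ℝ} (hw : HasCompactSupport w) :
    HasCompactSupport (gradient w) :=
  HasCompactSupport.intro hw fun _ hx => gradient_eq_zero_of_notMem_tsupport hx

end Gradient

/-! ### The Finsler energy of compactly supported functions -/

/-- The energy `∫ H(∇w)^N` over the whole space. -/
def finslerEnergy {N : ℕ} (H : Euc N → ℝ) (w : Euc N → ℝ) : ℝ :=
  ∫ x, H (gradient w x) ^ N

/-- Compactly supported functions of class `C¹`. -/
structure IsCompactC1 {N : ℕ} (w : Euc N → ℝ) : Prop where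
  contDiff : ContDiff ℝ 1 w
  hasCompactSupport : HasCompactSupport w

/-- The volume of the closed support. -/
def suppVol {N : ℕ} (w : Euc N → ℝ) : ℝ := volume.real (tsupport w)

lemma suppVol_nonneg {N : ℕ} (w : Euc N → ℝ) : 0 ≤ suppVol w := measureReal_nonneg

namespace IsCompactC1

variable {N : ℕ} {H : Euc N → ℝ} {w v : Euc N → ℝ}

lemma continuous (hw : IsCompactC1 w) : Continuous w := hw.contDiff.continuous

lemma differentiable (hw : IsCompactC1 w) : Differentiable ℝ w :=
  hw.contDiff.differentiable one_ne_zero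

lemma const_mul (hw : IsCompactC1 w) (c : ℝ) : IsCompactC1 (fun x => c * w x) :=
  ⟨contDiff_const.mul hw.contDiff, hw.hasCompactSupport.mul_left⟩

lemma mul (hv : IsCompactC1 v) (hw : IsCompactC1 w) : IsCompactC1 (fun x => v x * w x) :=
  ⟨hv.contDiff.mul hw.contDiff, hw.hasCompactSupport.mul_left⟩

lemma comp_affine (hw : IsCompactC1 w) {k : ℝ} (hk : k ≠ 0) (a : Euc N) :
    IsCompactC1 (fun x => w (k • x + a)) := by
  refine ⟨hw.contDiff.comp (by fun_prop), ?_⟩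
  exact hw.hasCompactSupport.comp_homeomorph
    ((Homeomorph.smulOfNeZero k hk).trans (Homeomorph.addRight a))

lemma comp_real (hw : IsCompactC1 w) {F : ℝ → ℝ} (hF : ContDiff ℝ 1 F) (hF0 : F 0 = 0) :
    IsCompactC1 (fun x => F (w x)) :=
  ⟨hF.comp hw.contDiff, hw.hasCompactSupport.comp_left hF0⟩

lemma tsupport_ne_top (hw : IsCompactC1 w) : volume (tsupport w) ≠ ⊤ :=
  IsCompact.measure_ne_top hw.hasCompactSupport

lemma integrable_energy (hw : IsCompactC1 w) (hH : IsFinslerNorm N H) (hN : N ≠ 0) :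
    Integrable (fun x => H (gradient w x) ^ N) := by
  refine Continuous.integrable_of_hasCompactSupport
    ((hH.continuous.comp (continuous_gradient hw.contDiff)).pow N) ?_
  exact (hasCompactSupport_gradient hw.hasCompactSupport).comp_left (g := fun ξ => H ξ ^ N)
    (by simp [hH.map_zero, hN])

lemma integrable_rpow (hw : IsCompactC1 w) {q : ℝ} (hq : 0 < q) :
    Integrable (fun x => |w x| ^ q) := by
  refine Continuous.integrable_of_hasCompactSupport
    (hw.continuous.abs.rpow_const fun _ => Or.inr hq.le) ?_
  exact hw.hasCompactSupport.comp_left (g := fun r => |r| ^ q) (by simp [hq.ne'])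

end IsCompactC1

section Energy

variable {N : ℕ} {H : Euc N → ℝ} {w : Euc N → ℝ}

lemma finslerEnergy_nonneg (hH : IsFinslerNorm N H) (w : Euc N → ℝ) : 0 ≤ finslerEnergy H w :=
  integral_nonneg fun _ => pow_nonneg (hH.nonneg _) _

lemma integral_comp_affine (f : Euc N → ℝ) {k : ℝ} (hk : 0 < k) (a : Euc N) :
    ∫ x, f (k • x + a) = (k ^ N)⁻¹ * ∫ x, f x := by
  rw [Measure.integral_comp_smul volume (fun x => f (x + a)) k, integral_add_right_eq_self f a,
    finrank_euclideanSpace_fin, abs_of_pos (by positivity), smul_eq_mul]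

lemma finslerEnergy_comp_affine (hH : IsFinslerNorm N H) (hw : IsCompactC1 w) {k : ℝ} (hk : 0 < k)
    (a : Euc N) : finslerEnergy H (fun x => w (k • x + a)) = finslerEnergy H w := by
  unfold finslerEnergy
  have h (x : Euc N) : H (gradient (fun y => w (k • y + a)) x) ^ N
      = k ^ N * H (gradient w (k • x + a)) ^ N := by
    rw [gradient_comp_affine k a hw.differentiable, hH.map_smul, abs_of_pos hk, mul_pow]
  simp_rw [h]
  rw [integral_const_mul, integral_comp_affine (fun x => H (gradient w x) ^ N) hk a]
  field_simp

lemma finslerEnergy_const_mul (hH : IsFinslerNorm N H) (hw : IsCompactC1 w) (c : ℝ) :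
    finslerEnergy H (fun x => c * w x) = |c| ^ N * finslerEnergy H w := by
  unfold finslerEnergy
  have h (x : Euc N) : H (gradient (fun y => c * w y) x) ^ N
      = |c| ^ N * H (gradient w x) ^ N := by
    rw [gradient_const_mul c (hw.differentiable x), hH.map_smul, mul_pow]
  simp_rw [h]
  rw [integral_const_mul]

/-- The Gagliardo–Nirenberg–Sobolev inequality in the critical dimension, with the explicit
dependence on the volume of the support. -/
lemma exists_sobolev (hN : 2 ≤ N) (hH : IsFinslerNorm N H) {b : ℕ} (hb : 1 ≤ b) :
    ∃ S : ℝ, 0 < S ∧ ∀ w : Euc N → ℝ, IsCompactC1 w →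
      ∫ x, |w x| ^ (N * b) ≤ S * suppVol w * finslerEnergy H w ^ b := by
  obtain ⟨c, hc, hcH⟩ := hH.exists_ge
  have hN0 : (0 : ℝ) < N := by positivity
  have hb0 : (0 : ℝ) < b := by positivity
  obtain ⟨p, hp⟩ : ∃ p : ℝ≥0, p = (N * b) / (1 + b) := ⟨_, rfl⟩
  obtain ⟨m, hm⟩ : ∃ m : ℝ≥0, m = N * b := ⟨_, rfl⟩
  have hp1 : 1 ≤ p := by
    rw [hp, one_le_div (by positivity)]
    have : 1 + b ≤ N * b := by nlinarith
    exact_mod_cast this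
  have hm0 : m ≠ 0 := by
    rw [hm]
    positivity
  set K : ℝ≥0 := SNormLESNormFDerivOfEqConst ℝ (volume : Measure (Euc N)) p
  refine ⟨(K + 1) ^ (N * b) * (c⁻¹) ^ (N * b), by positivity, fun w hw => ?_⟩
  have hmem_w : MemLp w m volume :=
    hw.continuous.memLp_of_hasCompactSupport hw.hasCompactSupport
  have hmem_d : MemLp (fderiv ℝ w) (N : ℝ≥0) volume :=
    (hw.contDiff.continuous_fderiv one_ne_zero).memLp_of_hasCompactSupport
      (hw.hasCompactSupport.fderiv (𝕜 := ℝ))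
  have h1 : eLpNorm w m volume ≤ K * eLpNorm (fderiv ℝ w) p volume := by
    refine eLpNorm_le_eLpNorm_fderiv_of_eq volume hw.contDiff hw.hasCompactSupport hp1
      (by rw [finrank_euclideanSpace_fin]; omega) ?_
    rw [finrank_euclideanSpace_fin, hp, hm]
    push_cast
    field_simp
    ring
  have hsub : Function.support (fderiv ℝ w) ⊆ tsupport w := support_fderiv_subset ℝ
  have h2 : eLpNorm (fderiv ℝ w) p volume ≤
      eLpNorm (fderiv ℝ w) (N : ℝ≥0) volume * volume (tsupport w) ^ (1 / ((N : ℝ) * b)) := by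
    have hres (q : ENNReal) : eLpNorm (fderiv ℝ w) q (volume.restrict (tsupport w))
        = eLpNorm (fderiv ℝ w) q volume :=
      eLpNorm_restrict_eq_of_support_subset (f := fderiv ℝ w) hsub
    rw [← hres, ← hres]
    have hpN : p ≤ (N : ℝ≥0) := by
      rw [hp, div_le_iff₀ (by positivity)]
      gcongr
      simp
    refine (eLpNorm_le_eLpNorm_mul_rpow_measure_univ (ENNReal.coe_le_coe.2 hpN)
      hmem_d.aestronglyMeasurable.restrict).trans (le_of_eq ?_)
    congr 2
    · simp
    · simp only [ENNReal.coe_toReal, hp]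
      push_cast
      field_simp
      ring
  have h3 := h1.trans (mul_le_mul_right h2 _)
  rw [hmem_w.eLpNorm_eq_integral_rpow_norm (by simpa using hm0) (by simp),
    hmem_d.eLpNorm_eq_integral_rpow_norm (by simp; omega) (by simp)] at h3
  set A := ∫ x, ‖w x‖ ^ (ENNReal.toReal (m : ENNReal)) with hA
  set B := ∫ x, ‖fderiv ℝ w x‖ ^ (ENNReal.toReal ((N : ℝ≥0) : ENNReal)) with hB
  have hA0 : 0 ≤ A := integral_nonneg fun x => by positivity
  have hB0 : 0 ≤ B := integral_nonneg fun x => by positivity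
  have hV : volume (tsupport w) = ENNReal.ofReal (suppVol w) :=
    (ofReal_measureReal hw.tsupport_ne_top).symm
  have hK : (K : ENNReal) = ENNReal.ofReal K := by simp
  rw [hV, ENNReal.ofReal_rpow_of_nonneg (suppVol_nonneg w) (by positivity), hK,
    ← ENNReal.ofReal_mul (by positivity), ← ENNReal.ofReal_mul (by positivity),
    ENNReal.ofReal_le_ofReal_iff (by have := suppVol_nonneg w; positivity)] at h3
  have hmr : ENNReal.toReal (m : ENNReal) = ((N * b : ℕ) : ℝ) := by simp [hm]
  have hNr : ENNReal.toReal ((N : ℝ≥0) : ENNReal) = (N : ℝ) := by simp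
  rw [hmr, hNr] at h3
  have h4 := pow_le_pow_left₀ (by positivity) h3 (N * b)
  have hNb : N * b ≠ 0 := by positivity
  rw [Real.rpow_inv_natCast_pow hA0 hNb, mul_pow, mul_pow, pow_mul (B ^ _),
    Real.rpow_inv_natCast_pow hB0 (by omega : N ≠ 0), one_div,
    show ((N : ℝ) * b) = ((N * b : ℕ) : ℝ) by push_cast; rfl,
    Real.rpow_inv_natCast_pow (suppVol_nonneg w) hNb] at h4
  have hA' : ∫ x, |w x| ^ (N * b) = A := by
    rw [hA, hmr]
    simp_rw [Real.rpow_natCast, Real.norm_eq_abs]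
  have hBle : B ≤ (c⁻¹) ^ N * finslerEnergy H w := by
    rw [hB, hNr, finslerEnergy, ← integral_const_mul]
    refine integral_mono ?_ ((hw.integrable_energy hH (by omega)).const_mul _) fun x => ?_
    · have := hmem_d.integrable_norm_rpow (by simp; omega) (by simp)
      rwa [hNr] at this
    · dsimp only
      rw [Real.rpow_natCast, ← mul_pow]
      refine pow_le_pow_left₀ (norm_nonneg _) ?_ _
      rw [← norm_gradient_eq, le_inv_mul_iff₀ hc]
      exact hcH _
  rw [hA']
  refine h4.trans ?_
  have hE := finslerEnergy_nonneg hH w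
  have hV0 := suppVol_nonneg w
  calc (K : ℝ) ^ (N * b) * (B ^ b * suppVol w)
      ≤ (K + 1 : ℝ) ^ (N * b) * (((c⁻¹) ^ N * finslerEnergy H w) ^ b * suppVol w) := by
        gcongr
        linarith
    _ = _ := by
        rw [mul_pow, ← pow_mul]
        ring

end Energy

/-! ### Smooth approximation and the Sobolev quotient -/

section Mollify

variable {N : ℕ} {H : Euc N → ℝ} {w : Euc N → ℝ}

open ContinuousLinearMap in
lemma IsCompactC1.exists_smooth_approx (hw : IsCompactC1 w) {Ω : Set (Euc N)} (hΩ : IsOpen Ω)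
    (hsub : tsupport w ⊆ Ω) {ε : ℝ} (hε : 0 < ε) :
    ∃ φ : Euc N → ℝ, ContDiff ℝ (⊤ : ℕ∞) φ ∧ HasCompactSupport φ ∧ tsupport φ ⊆ Ω ∧
      ∀ x, |φ x - w x| ≤ ε ∧ ‖gradient φ x - gradient w x‖ ≤ ε := by
  obtain ⟨δ₀, hδ₀, hδ₀Ω⟩ :=
    IsCompact.exists_cthickening_subset_open hw.hasCompactSupport hΩ hsub
  have hcd : Continuous (fderiv ℝ w) := hw.contDiff.continuous_fderiv one_ne_zero
  have hu1 := hw.hasCompactSupport.uniformContinuous_of_continuous hw.continuous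
  have hu2 := (hw.hasCompactSupport.fderiv (𝕜 := ℝ)).uniformContinuous_of_continuous hcd
  obtain ⟨δ₁, hδ₁, h1⟩ := Metric.uniformContinuous_iff.1 hu1 ε hε
  obtain ⟨δ₂, hδ₂, h2⟩ := Metric.uniformContinuous_iff.1 hu2 ε hε
  set r := min δ₀ (min δ₁ δ₂) with hr
  have hr0 : 0 < r := lt_min hδ₀ (lt_min hδ₁ hδ₂)
  let ψ : ContDiffBump (0 : Euc N) := ⟨r / 2, r, half_pos hr0, half_lt_self hr0⟩
  set φ : Euc N → ℝ := convolution (ψ.normed volume) w (lsmul ℝ ℝ) volume with hφ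
  have hz : ∀ x ∉ Metric.cthickening δ₀ (tsupport w), φ x = 0 := by
    intro x hx
    have hx' : ∀ y ∈ Metric.ball x r, w y = 0 := by
      intro y hy
      by_contra hne
      refine hx (Metric.mem_cthickening_of_dist_le x y δ₀ _ (subset_tsupport w hne) ?_)
      rw [dist_comm]
      exact (Metric.mem_ball.1 hy).le.trans (min_le_left _ _)
    have := ψ.dist_normed_convolution_le (μ := volume) (g := w) (x₀ := x) (ε := 0)
      hw.continuous.aestronglyMeasurable
      (fun y hy => by rw [hx' y hy, hx' x (Metric.mem_ball_self hr0)]; simp)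
    rw [hx' x (Metric.mem_ball_self hr0)] at this
    simpa using this
  refine ⟨φ, ?_, ?_, ?_, fun x => ⟨?_, ?_⟩⟩
  · exact ψ.hasCompactSupport_normed.contDiff_convolution_left _ ψ.contDiff_normed
      hw.continuous.locallyIntegrable
  · exact HasCompactSupport.intro hw.hasCompactSupport.isCompact.cthickening hz
  · refine (closure_minimal (fun x hx => ?_) Metric.isClosed_cthickening).trans hδ₀Ω
    by_contra hne
    exact hx (hz x hne)
  · rw [← Real.dist_eq]
    refine ψ.dist_normed_convolution_le hw.continuous.aestronglyMeasurable fun y hy => ?_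
    exact (h1 (lt_of_lt_of_le (Metric.mem_ball.1 hy)
      ((min_le_right _ _).trans (min_le_left _ _)))).le
  · have hd : fderiv ℝ φ x
        = convolution (ψ.normed volume) (fderiv ℝ w) (lsmul ℝ ℝ) volume x :=
      (hw.hasCompactSupport.hasFDerivAt_convolution_right (lsmul ℝ ℝ)
        ψ.continuous_normed.locallyIntegrable hw.contDiff x).fderiv
    have : ‖fderiv ℝ φ x - fderiv ℝ w x‖ ≤ ε := by
      rw [hd, ← dist_eq_norm]
      refine ψ.dist_normed_convolution_le hcd.aestronglyMeasurable fun y hy => ?_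
      exact (h2 (lt_of_lt_of_le (Metric.mem_ball.1 hy)
        ((min_le_right _ _).trans (min_le_right _ _)))).le
    simpa [gradient, ← map_sub] using this

lemma setIntegral_eq_of_tsupport_subset {f : Euc N → ℝ} {Ω : Set (Euc N)}
    (h : ∀ x ∉ Ω, f x = 0) : ∫ x in Ω, f x = ∫ x, f x :=
  setIntegral_eq_integral_of_forall_compl_eq_zero h

lemma energyInf_nonneg (hH : IsFinslerNorm N H) (Ω : Set (Euc N)) (p : ℝ) :
    0 ≤ energyInf N H Ω p := by
  refine Real.sInf_nonneg ?_
  rintro c ⟨u, -, -, -, -, rfl⟩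
  exact integral_nonneg fun x => pow_nonneg (hH.nonneg _) _

lemma energyInf_mul_le_of_smooth (hH : IsFinslerNorm N H) {Ω : Set (Euc N)} {p : ℝ} (hp : 0 < p)
    (hN : N ≠ 0) {φ : Euc N → ℝ} (h1 : ContDiff ℝ (⊤ : ℕ∞) φ) (h2 : HasCompactSupport φ)
    (h3 : tsupport φ ⊆ Ω) :
    energyInf N H Ω p * (∫ x in Ω, |φ x| ^ (p + 1)) ^ ((N : ℝ) / (p + 1))
      ≤ ∫ x in Ω, H (gradient φ x) ^ N := by
  set I := ∫ x in Ω, |φ x| ^ (p + 1) with hI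
  have hI0 : 0 ≤ I := integral_nonneg fun x => by positivity
  have hp1 : p + 1 ≠ 0 := by positivity
  have hN0 : (0 : ℝ) < N := by positivity
  rcases hI0.eq_or_lt with h0 | hpos
  · rw [← h0, Real.zero_rpow (by positivity), mul_zero]
    exact integral_nonneg fun x => pow_nonneg (hH.nonneg _) _
  set c : ℝ := I ^ (-(1 / (p + 1))) with hc
  have hc0 : 0 < c := Real.rpow_pos_of_pos hpos _
  have hle : energyInf N H Ω p ≤ ∫ x in Ω, H (gradient (fun y => c * φ y) x) ^ N := by
    refine csInf_le ⟨0, ?_⟩ ⟨fun y => c * φ y, contDiff_const.mul h1, h2.mul_left,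
      (closure_mono (Function.support_mul_subset_right _ _)).trans h3, ?_, rfl⟩
    · rintro c ⟨u, -, -, -, -, rfl⟩
      exact integral_nonneg fun x => pow_nonneg (hH.nonneg _) _
    · simp_rw [abs_mul, Real.mul_rpow (abs_nonneg _) (abs_nonneg _)]
      rw [integral_const_mul, ← hI, abs_of_pos hc0, hc, ← Real.rpow_mul hI0]
      rw [show -(1 / (p + 1)) * (p + 1) = -1 by field_simp, Real.rpow_neg_one,
        inv_mul_cancel₀ hpos.ne']
  have hg (x : Euc N) : H (gradient (fun y => c * φ y) x) ^ N
      = c ^ N * H (gradient φ x) ^ N := by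
    rw [gradient_const_mul c (h1.differentiable (by simp) x), hH.map_smul, abs_of_pos hc0, mul_pow]
  simp_rw [hg] at hle
  rw [integral_const_mul] at hle
  have hcN : c ^ N * I ^ ((N : ℝ) / (p + 1)) = 1 := by
    rw [hc, ← Real.rpow_natCast, ← Real.rpow_mul hI0, ← Real.rpow_add hpos]
    rw [show -(1 / (p + 1)) * (N : ℝ) + N / (p + 1) = 0 by field_simp; ring, Real.rpow_zero]
  calc _ ≤ (c ^ N * ∫ x in Ω, H (gradient φ x) ^ N) * I ^ ((N : ℝ) / (p + 1)) := by gcongr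
    _ = (c ^ N * I ^ ((N : ℝ) / (p + 1))) * ∫ x in Ω, H (gradient φ x) ^ N := by ring
    _ = _ := by rw [hcN, one_mul]

/-- The Sobolev quotient bound defining `energyInf` extends to compactly supported `C¹`
functions. -/
lemma energyInf_mul_le (hH : IsFinslerNorm N H) (hN : N ≠ 0) {Ω : Set (Euc N)} (hΩ : IsOpen Ω)
    (hΩb : Bornology.IsBounded Ω) {p : ℝ} (hp : 0 < p) (hw : IsCompactC1 w)
    (hsub : tsupport w ⊆ Ω) :
    energyInf N H Ω p * (∫ x, |w x| ^ (p + 1)) ^ ((N : ℝ) / (p + 1)) ≤ finslerEnergy H w := by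
  have hp1 : 0 < p + 1 := by positivity
  choose φ h1 h2 h3 h4 using fun n : ℕ =>
    hw.exists_smooth_approx hΩ hsub (ε := 1 / ((n : ℝ) + 1)) (by positivity)
  have hfin : IsFiniteMeasure (volume.restrict Ω) :=
    ⟨by simpa using hΩb.measure_lt_top⟩
  have hle1 (n : ℕ) : 1 / ((n : ℝ) + 1) ≤ 1 := by
    rw [div_le_one (by positivity)]
    linarith [n.cast_nonneg (α := ℝ)]
  have hlim := tendsto_one_div_add_atTop_nhds_zero_nat (𝕜 := ℝ)
  have hφlim (x : Euc N) : Tendsto (fun n => φ n x) atTop (𝓝 (w x)) := by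
    rw [tendsto_iff_dist_tendsto_zero]
    exact squeeze_zero (fun n => dist_nonneg) (fun n => by rw [Real.dist_eq]; exact (h4 n x).1) hlim
  have hglim (x : Euc N) : Tendsto (fun n => gradient (φ n) x) atTop (𝓝 (gradient w x)) := by
    rw [tendsto_iff_dist_tendsto_zero]
    exact squeeze_zero (fun n => dist_nonneg) (fun n => by rw [dist_eq_norm]; exact (h4 n x).2) hlim
  obtain ⟨M, hM⟩ := hw.hasCompactSupport.exists_bound_of_continuous hw.continuous
  obtain ⟨G, hG⟩ := (hasCompactSupport_gradient hw.hasCompactSupport).exists_bound_of_continuous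
    (continuous_gradient hw.contDiff)
  obtain ⟨C, hC, hCH⟩ := hH.exists_le
  have hM0 : 0 ≤ M := (norm_nonneg _).trans (hM 0)
  have hG0 : 0 ≤ G := (norm_nonneg _).trans (hG 0)
  have l1 : Tendsto (fun n => ∫ x in Ω, |φ n x| ^ (p + 1)) atTop
      (𝓝 (∫ x in Ω, |w x| ^ (p + 1))) := by
    refine tendsto_integral_of_dominated_convergence (fun _ => (M + 1) ^ (p + 1))
      (fun n => ?_) (integrable_const _) (fun n => ?_) ?_
    · exact ((h1 n).continuous.abs.rpow_const fun _ => Or.inr hp1.le).aestronglyMeasurable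
    · refine Eventually.of_forall fun x => ?_
      rw [Real.norm_of_nonneg (by positivity)]
      refine Real.rpow_le_rpow (abs_nonneg _) ?_ hp1.le
      have := hM x
      rw [Real.norm_eq_abs] at this
      have := abs_sub_abs_le_abs_sub (φ n x) (w x)
      linarith [(h4 n x).1, hle1 n]
    · exact Eventually.of_forall fun x => ((hφlim x).abs.rpow_const (Or.inr hp1.le))
  have l2 : Tendsto (fun n => ∫ x in Ω, H (gradient (φ n) x) ^ N) atTop
      (𝓝 (∫ x in Ω, H (gradient w x) ^ N)) := by
    refine tendsto_integral_of_dominated_convergence (fun _ => (C * (G + 1)) ^ N)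
      (fun n => ?_) (integrable_const _) (fun n => ?_) ?_
    · exact ((hH.continuous.comp (continuous_gradient ((h1 n).of_le (by simp)))).pow
        N).aestronglyMeasurable
    · refine Eventually.of_forall fun x => ?_
      rw [Real.norm_of_nonneg (pow_nonneg (hH.nonneg _) _)]
      refine pow_le_pow_left₀ (hH.nonneg _) ((hCH _).trans ?_) _
      gcongr
      have := norm_sub_norm_le (gradient (φ n) x) (gradient w x)
      linarith [(h4 n x).2, hle1 n, hG x]
    · exact Eventually.of_forall fun x =>
        (((hH.continuous.tendsto _).comp (hglim x)).pow N)
  have l3 := (l1.rpow_const (p := (N : ℝ) / (p + 1))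
    (Or.inr (by positivity))).const_mul (energyInf N H Ω p)
  have hfinal := le_of_tendsto_of_tendsto' l3 l2 fun n =>
    energyInf_mul_le_of_smooth hH hp hN (h1 n) (h2 n) (h3 n)
  rwa [setIntegral_eq_of_tsupport_subset fun x hx => ?_,
    setIntegral_eq_of_tsupport_subset fun x hx => ?_] at hfinal
  · rw [gradient_eq_zero_of_notMem_tsupport fun h => hx (hsub h), hH.map_zero, zero_pow hN]
  · have : w x = 0 := image_eq_zero_of_notMem_tsupport fun h => hx (hsub h)
    rw [this, abs_zero, Real.zero_rpow hp1.ne']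

/-- By dilation and translation, the Sobolev quotient bound on `Ω` controls functions supported in
arbitrary balls. -/
lemma energyInf_mul_le_of_ball (hH : IsFinslerNorm N H) (hN : N ≠ 0) {Ω : Set (Euc N)}
    (hΩ : IsOpen Ω) (hΩb : Bornology.IsBounded Ω) {x₀ : Euc N} {ρ : ℝ} (hρ : 0 < ρ)
    (hball : Metric.closedBall x₀ ρ ⊆ Ω) {p : ℝ} (hp : 0 < p) (hw : IsCompactC1 w) {y : Euc N}
    {R : ℝ} (hR : 0 < R) (hsub : tsupport w ⊆ Metric.closedBall y R) :
    energyInf N H Ω p * ((ρ / R) ^ N * ∫ x, |w x| ^ (p + 1)) ^ ((N : ℝ) / (p + 1))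
      ≤ finslerEnergy H w := by
  set k := R / ρ with hk
  have hk0 : 0 < k := by positivity
  set a := y - k • x₀ with ha
  have hw' := hw.comp_affine hk0.ne' a
  have h := energyInf_mul_le hH hN hΩ hΩb hp hw' ?_
  · rw [finslerEnergy_comp_affine hH hw hk0, integral_comp_affine (fun x => |w x| ^ (p + 1)) hk0]
      at h
    convert h using 5
    rw [hk, ← inv_pow, inv_div]
  · refine subset_trans ?_ hball
    refine closure_minimal (fun x hx => ?_) Metric.isClosed_closedBall
    have h1 := hsub (subset_tsupport w hx)
    rw [Metric.mem_closedBall, dist_eq_norm] at h1 ⊢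
    have h2 : k • x + a - y = k • (x - x₀) := by
      rw [ha, smul_sub]
      abel
    rw [h2, norm_smul, Real.norm_of_nonneg hk0.le, hk, div_mul_eq_mul_div,
      div_le_iff₀ hρ] at h1
    exact le_of_mul_le_mul_left h1 hR

end Mollify

/-! ### Localization -/

section Localization

variable {N : ℕ} {H : Euc N → ℝ} {w : Euc N → ℝ}

open ContinuousLinearMap in
lemma integral_average {f g : Euc N → ℝ} (hf : Integrable f) (hg : Integrable g) {k : ℝ}
    (hk : 0 < k) :
    Integrable (fun y => ∫ x, f (k • x + -(k • y)) * g x) ∧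
      ∫ y, ∫ x, f (k • x + -(k • y)) * g x = (k ^ N)⁻¹ * (∫ x, f x) * ∫ x, g x := by
  have hf' : Integrable (fun z => f ((-k) • z)) := hf.comp_smul (neg_ne_zero.2 hk.ne')
  have hconv : (fun y => ∫ x, f (k • x + -(k • y)) * g x)
      = convolution g (fun z => f ((-k) • z)) (lsmul ℝ ℝ) volume := by
    ext y
    rw [convolution]
    refine integral_congr_ae (Eventually.of_forall fun x => ?_)
    simp only [lsmul_apply, smul_eq_mul, neg_smul, smul_sub]
    rw [mul_comm]
    congr 2
    abel
  rw [hconv]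
  refine ⟨hg.integrable_convolution _ hf', ?_⟩
  rw [integral_convolution _ hg hf', lsmul_apply, smul_eq_mul, Measure.integral_comp_smul,
    finrank_euclideanSpace_fin, abs_inv, abs_pow, abs_neg, abs_of_pos hk, smul_eq_mul]
  ring

/-- The energy of a product, with the two contributions of the product rule separated. -/
lemma finslerEnergy_mul_le (hH : IsFinslerNorm N H) (hN : N ≠ 0) {v : Euc N → ℝ}
    (hv : IsCompactC1 v) (hw : IsCompactC1 w) {τ : ℝ} (hτ : 0 < τ) (hτ1 : τ < 1) :
    finslerEnergy H (fun x => v x * w x)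
      ≤ (∫ x, |v x| ^ N * H (gradient w x) ^ N) / (1 - τ) ^ (N - 1)
        + (∫ x, H (gradient v x) ^ N * |w x| ^ N) / τ ^ (N - 1) := by
  have hint {f g : Euc N → ℝ} (hf : IsCompactC1 f) (hg : IsCompactC1 g) :
      Integrable (fun x => |f x| ^ N * H (gradient g x) ^ N) := by
    refine Continuous.integrable_of_hasCompactSupport ((hf.continuous.abs.pow N).mul
      ((hH.continuous.comp (continuous_gradient hg.contDiff)).pow N)) ?_
    exact (hf.hasCompactSupport.comp_left (g := fun r => |r| ^ N) (by simp [hN])).mul_right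
  have hint' : Integrable (fun x => H (gradient v x) ^ N * |w x| ^ N) := by
    simpa only [mul_comm] using hint hw hv
  rw [← integral_div, ← integral_div, ← integral_add ((hint hv hw).div_const _)
    (hint'.div_const _)]
  refine integral_mono ((hv.mul hw).integrable_energy hH hN)
    (((hint hv hw).div_const _).add (hint'.div_const _)) fun x => ?_
  dsimp only
  rw [gradient_mul (hv.differentiable x) (hw.differentiable x)]
  have h1 := hH.add_le (v x • gradient w x) (w x • gradient v x)
  rw [hH.map_smul, hH.map_smul] at h1
  refine (pow_le_pow_left₀ (hH.nonneg _) h1 N).trans ?_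
  refine (add_pow_le_weighted (Nat.one_le_iff_ne_zero.2 hN)
    (mul_nonneg (abs_nonneg _) (hH.nonneg _)) (mul_nonneg (abs_nonneg _) (hH.nonneg _))
    (sub_pos.2 hτ1) hτ).trans (le_of_eq ?_)
  rw [sub_add_cancel, one_pow, one_mul, mul_pow, mul_pow, mul_comm (|w x| ^ N)]

lemma exists_localization_parameter (N : ℕ) {ε : ℝ} (hε : 0 < ε) :
    ∃ s : ℝ, 0 < s ∧ s < 1 ∧ (1 + s) ^ N / (1 - s) ^ (N - 1) < 1 + ε := by
  have hc : ContinuousAt (fun s : ℝ => (1 + s) ^ N / (1 - s) ^ (N - 1)) 0 := by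
    refine ContinuousAt.div (by fun_prop) (by fun_prop) (by simp)
  have h1 : ∀ᶠ s in 𝓝 (0 : ℝ), (1 + s) ^ N / (1 - s) ^ (N - 1) < 1 + ε :=
    hc.eventually_lt continuousAt_const (by simpa using hε)
  have h2 : ∀ᶠ s in 𝓝[>] (0 : ℝ), s ∈ Ioo (0 : ℝ) 1 := Ioo_mem_nhdsGT one_pos
  obtain ⟨s, h3, h4⟩ := ((h1.filter_mono nhdsWithin_le_nhds).and h2).exists
  exact ⟨s, h4.1, h4.2, h3⟩

/-- The Sobolev quotient bound on `Ω` holds, up to a factor close to `1`, for all compactly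
supported functions, with a constant that only involves the volume of the support. -/
lemma exists_localization (hN : 2 ≤ N) (hH : IsFinslerNorm N H) {Ω : Set (Euc N)}
    (hΩ : IsOpen Ω) (hΩb : Bornology.IsBounded Ω) (hΩne : Ω.Nonempty) {ε : ℝ} (hε : 0 < ε) :
    ∃ A : ℝ, 0 < A ∧ ∀ p : ℝ, 0 < p → (N : ℝ) ≤ p + 1 → ∀ w : Euc N → ℝ, IsCompactC1 w →
      0 < suppVol w →
      energyInf N H Ω p * (A * (∫ x, |w x| ^ (p + 1)) / suppVol w) ^ ((N : ℝ) / (p + 1))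
        ≤ (1 + ε) * finslerEnergy H w := by
  have hN0 : N ≠ 0 := by omega
  obtain ⟨x₀, hx₀⟩ := hΩne
  obtain ⟨ρ, hρ, hball⟩ := Metric.nhds_basis_closedBall.mem_iff.1 (hΩ.mem_nhds hx₀)
  obtain ⟨S, hS, hSob⟩ := exists_sobolev hN hH (le_refl 1)
  obtain ⟨s, hs, hs1, hsε⟩ := exists_localization_parameter N (half_pos hε)
  let χ : ContDiffBump (0 : Euc N) := ⟨1, 1 + s, one_pos, by linarith⟩
  have hχ : IsCompactC1 χ := ⟨χ.contDiff, χ.hasCompactSupport⟩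
  set ω : ℝ := volume.real (Metric.closedBall (0 : Euc N) 1) with hω
  have hω0 : 0 < ω := by
    rw [hω, measureReal_def]
    exact ENNReal.toReal_pos (Metric.measure_closedBall_pos _ _ one_pos).ne'
      (isCompact_closedBall _ _).measure_lt_top.ne
  set G : ℝ := finslerEnergy H χ with hG
  have hG0 : 0 ≤ G := finslerEnergy_nonneg hH _
  obtain ⟨R₀, hR₀, hR₀G⟩ : ∃ R₀ : ℝ, 1 ≤ R₀ ∧ G * S / (ω * s ^ (N - 1)) ≤ (ε / 2) * R₀ ^ N := by
    set K := G * S / (ω * s ^ (N - 1)) with hK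
    refine ⟨max 1 (K / (ε / 2)), le_max_left _ _, ?_⟩
    have h1 := le_self_pow₀ (le_max_left 1 (K / (ε / 2))) hN0
    calc K = (ε / 2) * (K / (ε / 2)) := by field_simp
      _ ≤ _ := by
        gcongr
        exact (le_max_right _ _).trans h1
  have hR₀0 : 0 < R₀ := by linarith
  refine ⟨(ρ / (R₀ * (1 + s))) ^ N, by positivity, fun p hp hNp w hw hV => ?_⟩
  set V := suppVol w with hVdef
  have hp1 : 0 < p + 1 := by positivity
  obtain ⟨r, hr0, hrN⟩ : ∃ r : ℝ, 0 < r ∧ r ^ N = V :=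
    ⟨V ^ (1 / (N : ℝ)), by positivity, by
      rw [one_div, Real.rpow_inv_natCast_pow hV.le hN0]⟩
  set R := R₀ * r with hR
  have hR0 : 0 < R := by positivity
  set k := R⁻¹ with hk
  have hk0 : 0 < k := by positivity
  set θ := (N : ℝ) / (p + 1) with hθ
  have hθ0 : 0 < θ := by positivity
  have hθ1 : θ ≤ 1 := by rwa [hθ, div_le_one hp1]
  set a := ∫ x, |w x| ^ (p + 1) with ha
  have ha0 : 0 ≤ a := integral_nonneg fun x => by positivity
  have hC0 := energyInf_nonneg hH Ω p (N := N)
  have he0 := finslerEnergy_nonneg hH w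
  rcases ha0.eq_or_lt with ha00 | hapos
  · rw [← ha00, mul_zero, zero_div, Real.zero_rpow hθ0.ne', mul_zero]
    positivity
  set v : Euc N → Euc N → ℝ := fun y x => χ (k • x + -(k • y)) with hv
  have hvC (y : Euc N) : IsCompactC1 (v y) := hχ.comp_affine hk0.ne' _
  have hvsupp (y : Euc N) : tsupport (fun x => v y x * w x) ⊆ Metric.closedBall y (R * (1 + s)) := by
    refine closure_minimal (fun x hx => ?_) Metric.isClosed_closedBall
    have h1 : k • x + -(k • y) ∈ tsupport χ := subset_tsupport χ (left_ne_zero_of_mul hx)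
    rw [χ.tsupport_eq, mem_closedBall_zero_iff, ← sub_eq_add_neg, ← smul_sub, norm_smul,
      Real.norm_of_nonneg hk0.le, hk, inv_mul_le_iff₀ hR0] at h1
    rwa [Metric.mem_closedBall, dist_eq_norm]
  set b : Euc N → ℝ := fun y => ∫ x, |χ (k • x + -(k • y))| ^ (p + 1) * |w x| ^ (p + 1) with hb
  set κ := (ρ / (R * (1 + s))) ^ N with hκ
  have hκ0 : 0 < κ := by positivity
  have hκV : κ = (ρ / (R₀ * (1 + s))) ^ N / V := by
    rw [hκ, ← hrN, ← div_pow, hR]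
    congr 1
    field_simp
  have hb1 (y : Euc N) : (b y) ≤ a := by
    refine integral_mono_of_nonneg (Eventually.of_forall fun x => by positivity)
      (hw.integrable_rpow hp1) (Eventually.of_forall fun x => ?_)
    dsimp only
    have : |χ (k • x + -(k • y))| ^ (p + 1) ≤ 1 :=
      Real.rpow_le_one (abs_nonneg _) (by rw [abs_of_nonneg χ.nonneg]; exact χ.le_one) hp1.le
    exact mul_le_of_le_one_left (by positivity) this
  have hb0 (y : Euc N) : 0 ≤ b y := integral_nonneg fun x => by positivity
  have hkey (y : Euc N) : energyInf N H Ω p * (κ * a) ^ θ / a * b y ≤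
      (∫ x, |χ (k • x + -(k • y))| ^ N * H (gradient w x) ^ N) / (1 - s) ^ (N - 1)
      + k ^ N * (∫ x, H (gradient χ (k • x + -(k • y))) ^ N * |w x| ^ N) / s ^ (N - 1) := by
    have h1 := energyInf_mul_le_of_ball hH hN0 hΩ hΩb hρ hball hp ((hvC y).mul hw)
      (by positivity : 0 < R * (1 + s)) (hvsupp y)
    have h2 := finslerEnergy_mul_le hH hN0 (hvC y) hw hs hs1
    have h3 : ∫ x, H (gradient (v y) x) ^ N * |w x| ^ N
        = k ^ N * ∫ x, H (gradient χ (k • x + -(k • y))) ^ N * |w x| ^ N := by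
      rw [← integral_const_mul]
      congr 1
      ext x
      rw [hv, gradient_comp_affine k _ hχ.differentiable, hH.map_smul, abs_of_pos hk0, mul_pow,
        mul_assoc]
    rw [h3] at h2
    refine le_trans ?_ (h1.trans h2)
    have h4 : ∫ x, |v y x * w x| ^ (p + 1) = b y := by
      rw [hb]
      congr 1
      ext x
      rw [abs_mul, Real.mul_rpow (abs_nonneg _) (abs_nonneg _)]
    rw [h4, mul_div_assoc, mul_assoc]
    refine mul_le_mul_of_nonneg_left ?_ hC0
    have h5 : κ * b y = (κ * a) * (b y / a) := by field_simp
    have hκa : 0 ≤ κ * a := by positivity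
    rw [h5, Real.mul_rpow hκa (div_nonneg (hb0 y) ha0), div_mul_eq_mul_div, mul_div_assoc]
    refine mul_le_mul_of_nonneg_left ?_ (by positivity)
    exact Real.self_le_rpow_of_le_one (div_nonneg (hb0 y) ha0) ((div_le_one hapos).2 (hb1 y)) hθ1
  have i1 := integral_average (hχ.integrable_rpow hp1) (hw.integrable_rpow hp1) hk0
  have hχN : Integrable (fun x => |χ x| ^ N) := by
    simpa using hχ.integrable_rpow (q := N) (by positivity)
  have hwN : Integrable (fun x => |w x| ^ N) := by
    simpa using hw.integrable_rpow (q := N) (by positivity)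
  have i2 := integral_average hχN (hw.integrable_energy hH hN0) hk0
  have i3 := integral_average (hχ.integrable_energy hH hN0) hwN hk0
  have hint := integral_mono (i1.1.const_mul _)
    ((i2.1.div_const _).add ((i3.1.const_mul (k ^ N)).div_const _)) hkey
  simp only [Pi.add_apply] at hint
  rw [integral_add (i2.1.div_const _) ((i3.1.const_mul (k ^ N)).div_const _),
    integral_const_mul, integral_div, integral_div, integral_const_mul, i1.2, i2.2, i3.2] at hint
  have hlow : ω ≤ ∫ x, |χ x| ^ (p + 1) := by
    rw [hω, ← integral_indicator_one Metric.isClosed_closedBall.measurableSet]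
    refine integral_mono_of_nonneg (Eventually.of_forall fun x => ?_) (hχ.integrable_rpow hp1)
      (Eventually.of_forall fun x => ?_)
    · exact indicator_nonneg (fun _ _ => zero_le_one) _
    · dsimp only
      by_cases hx : x ∈ Metric.closedBall (0 : Euc N) 1
      · rw [indicator_of_mem hx, χ.one_of_mem_closedBall hx]
        simp
      · rw [indicator_of_notMem hx]
        positivity
  have hup : ∫ x, |χ x| ^ N ≤ (1 + s) ^ N * ω := by
    have h1 : (1 + s) ^ N * ω = volume.real (Metric.closedBall (0 : Euc N) (1 + s)) := by
      rw [Measure.addHaar_real_closedBall' _ _ (by positivity), finrank_euclideanSpace_fin]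
    rw [h1, ← integral_indicator_one Metric.isClosed_closedBall.measurableSet]
    refine integral_mono hχN ?_ fun x => ?_
    · rw [integrable_indicator_iff Metric.isClosed_closedBall.measurableSet]
      exact integrableOn_const (isCompact_closedBall _ _).measure_lt_top.ne
    · dsimp only
      by_cases hx : x ∈ Metric.closedBall (0 : Euc N) (1 + s)
      · rw [indicator_of_mem hx]
        exact pow_le_one₀ (abs_nonneg _) (by rw [abs_of_nonneg χ.nonneg]; exact χ.le_one)
      · rw [indicator_of_notMem hx]
        have : χ x = 0 := image_eq_zero_of_notMem_tsupport (by rwa [χ.tsupport_eq])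
        simp [this, hN0]
  have hpoin : ∫ x, |w x| ^ N ≤ S * V * finslerEnergy H w := by
    simpa using hSob w hw
  have hkN : k ^ N = (R₀ ^ N * V)⁻¹ := by rw [hk, inv_pow, hR, mul_pow, hrN]
  set e := finslerEnergy H w with he
  have hC1 : 0 ≤ energyInf N H Ω p * (κ * a) ^ θ := by positivity
  have hfin : energyInf N H Ω p * (κ * a) ^ θ * ω ≤ (1 + ε) * e * ω := by
    have h1 : (k ^ N)⁻¹ * (energyInf N H Ω p * (κ * a) ^ θ * ω)
        ≤ energyInf N H Ω p * (κ * a) ^ θ / a * ((k ^ N)⁻¹ * (∫ x, |χ x| ^ (p + 1)) * a) := by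
      calc _ ≤ (k ^ N)⁻¹ * (energyInf N H Ω p * (κ * a) ^ θ * ∫ x, |χ x| ^ (p + 1)) := by gcongr
        _ = _ := by field_simp
    have h2 := h1.trans hint
    have h3 : (k ^ N)⁻¹ * (∫ x, |χ x| ^ N) * e / (1 - s) ^ (N - 1)
        + k ^ N * ((k ^ N)⁻¹ * G * ∫ x, |w x| ^ N) / s ^ (N - 1)
        ≤ (k ^ N)⁻¹ * ((1 + ε) * e * ω) := by
      have hs' : 0 < (1 - s) ^ (N - 1) := pow_pos (by linarith) _
      have h4 : (k ^ N)⁻¹ * (∫ x, |χ x| ^ N) * e / (1 - s) ^ (N - 1)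
          ≤ (k ^ N)⁻¹ * ((1 + ε / 2) * e * ω) := by
        calc _ ≤ (k ^ N)⁻¹ * ((1 + s) ^ N * ω) * e / (1 - s) ^ (N - 1) := by gcongr
          _ = (k ^ N)⁻¹ * ((1 + s) ^ N / (1 - s) ^ (N - 1) * e * ω) := by ring
          _ ≤ _ := by gcongr
      have h5 : k ^ N * ((k ^ N)⁻¹ * G * ∫ x, |w x| ^ N) / s ^ (N - 1)
          ≤ (k ^ N)⁻¹ * ((ε / 2) * e * ω) := by
        calc _ = G * (∫ x, |w x| ^ N) / s ^ (N - 1) := by field_simp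
          _ ≤ G * (S * V * e) / s ^ (N - 1) := by gcongr
          _ = G * S / (ω * s ^ (N - 1)) * (V * e * ω) := by field_simp
          _ ≤ ((ε / 2) * R₀ ^ N) * (V * e * ω) := by gcongr
          _ = _ := by rw [hkN, inv_inv]; ring
      calc _ ≤ (k ^ N)⁻¹ * ((1 + ε / 2) * e * ω) + (k ^ N)⁻¹ * ((ε / 2) * e * ω) := add_le_add h4 h5
        _ = _ := by ring
    exact le_of_mul_le_mul_left (h2.trans h3) (by positivity)
  have := le_of_mul_le_mul_right hfin hω0
  rwa [hκV, div_mul_eq_mul_div] at this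

end Localization

/-! ### Truncation profiles -/

/-- `F` is a `C¹` approximation, up to the error `ε`, of the truncation
`r ↦ min (max (r - a) 0) (b - a)`. -/
structure IsProfile (a b ε : ℝ) (F : ℝ → ℝ) : Prop where
  contDiff : ContDiff ℝ 1 F
  deriv_nonneg : ∀ r, 0 ≤ deriv F r
  deriv_le_one : ∀ r, deriv F r ≤ 1
  deriv_eq_zero : ∀ r, r ≤ a ∨ b ≤ r → deriv F r = 0
  eq_zero : ∀ r, r ≤ a → F r = 0
  sub_le : ∀ r, r ≤ b → r - a - ε ≤ F r
  eq_right : ∀ r, b ≤ r → F r = F b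

namespace IsProfile

variable {a b ε : ℝ} {F : ℝ → ℝ}

lemma differentiable (hF : IsProfile a b ε F) : Differentiable ℝ F :=
  hF.contDiff.differentiable one_ne_zero

lemma monotone (hF : IsProfile a b ε F) : Monotone F :=
  monotone_of_deriv_nonneg hF.differentiable hF.deriv_nonneg

lemma nonneg (hF : IsProfile a b ε F) (r : ℝ) : 0 ≤ F r := by
  rcases le_total r a with h | h
  · exact (hF.eq_zero r h).ge
  · exact (hF.eq_zero a le_rfl).ge.trans (hF.monotone h)

lemma le_sub (hF : IsProfile a b ε F) {r : ℝ} (hr : a ≤ r) : F r ≤ r - a := by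
  have h := Convex.image_sub_le_mul_sub_of_deriv_le (convex_univ (𝕜 := ℝ)) (f := F)
    hF.differentiable.continuous.continuousOn hF.differentiable.differentiableOn (C := 1)
    (fun x _ => hF.deriv_le_one x) a (mem_univ _) r (mem_univ _) hr
  rw [hF.eq_zero a le_rfl] at h
  linarith

end IsProfile

lemma exists_isProfile {a b ε : ℝ} (hab : a < b) (hε : 0 < ε) : ∃ F, IsProfile a b ε F := by
  obtain ⟨η, hη, hηε, hηab⟩ : ∃ η : ℝ, 0 < η ∧ 2 * η ≤ ε ∧ 2 * η ≤ b - a :=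
    ⟨min ε (b - a) / 2, by have := lt_min hε (sub_pos.2 hab); linarith,
      by have := min_le_left ε (b - a); linarith, by have := min_le_right ε (b - a); linarith⟩
  set T : ℝ → ℝ := fun s => max 0 (min 1 (min (s - a) (b - s) / η)) with hT
  have hTc : Continuous T := by fun_prop
  have hT0 (s : ℝ) : 0 ≤ T s := le_max_left _ _
  have hT1 (s : ℝ) : T s ≤ 1 := max_le zero_le_one (min_le_left _ _)
  have hTz (s : ℝ) (hs : s ≤ a ∨ b ≤ s) : T s = 0 := by
    refine max_eq_left ((min_le_right _ _).trans (div_nonpos_of_nonpos_of_nonneg ?_ hη.le))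
    rcases hs with h | h
    · exact (min_le_left _ _).trans (by linarith)
    · exact (min_le_right _ _).trans (by linarith)
  have hTo (s : ℝ) (h₁ : a + η ≤ s) (h₂ : s ≤ b - η) : T s = 1 := by
    have : 1 ≤ min (s - a) (b - s) / η := by
      rw [le_div_iff₀ hη]
      exact le_min (by linarith) (by linarith)
    simp [hT, this]
  set F : ℝ → ℝ := fun r => ∫ s in a..r, T s with hF
  have hd (r : ℝ) : HasDerivAt F (T r) r :=
    intervalIntegral.integral_hasDerivAt_right (hTc.intervalIntegrable _ _)
      hTc.stronglyMeasurable.stronglyMeasurableAtFilter hTc.continuousAt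
  have hdF : deriv F = T := funext fun r => (hd r).deriv
  have hsub (r r' : ℝ) : F r' - F r = ∫ s in r..r', T s :=
    intervalIntegral.integral_interval_sub_left (hTc.intervalIntegrable _ _)
      (hTc.intervalIntegrable _ _)
  have hbF : b - a - ε ≤ F b := by
    have h1 : ∫ s in (a + η)..(b - η), (1 : ℝ) = ∫ s in (a + η)..(b - η), T s := by
      refine intervalIntegral.integral_congr fun s hs => ?_
      rw [uIcc_of_le (by linarith)] at hs
      exact (hTo s hs.1 hs.2).symm
    have h2 : ∫ s in (a + η)..(b - η), T s ≤ ∫ s in a..b, T s :=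
      intervalIntegral.integral_mono_interval (by linarith) (by linarith) (by linarith)
        (Eventually.of_forall hT0) (hTc.intervalIntegrable _ _)
    rw [← h1, intervalIntegral.integral_const, smul_eq_mul, mul_one] at h2
    have : F b = ∫ s in a..b, T s := rfl
    linarith
  refine ⟨F, ⟨?_, fun r => hdF ▸ hT0 r, fun r => hdF ▸ hT1 r, fun r hr => hdF ▸ hTz r hr, ?_, ?_,
    ?_⟩⟩
  · exact contDiff_one_iff_deriv.2 ⟨fun r => (hd r).differentiableAt, hdF ▸ hTc⟩
  · intro r hr
    have : ∫ s in a..r, T s = ∫ s in a..r, (0 : ℝ) := by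
      refine intervalIntegral.integral_congr fun s hs => ?_
      rw [uIcc_of_ge hr] at hs
      exact hTz s (Or.inl hs.2)
    simpa [hF] using this
  · intro r hr
    have h1 := hsub r b
    have h2 : ∫ s in r..b, T s ≤ ∫ s in r..b, (1 : ℝ) :=
      intervalIntegral.integral_mono_on hr (hTc.intervalIntegrable _ _)
        intervalIntegrable_const fun s _ => hT1 s
    rw [intervalIntegral.integral_const, smul_eq_mul, mul_one] at h2
    linarith
  · intro r hr
    have h1 := hsub b r
    have h2 : ∫ s in b..r, T s = ∫ s in b..r, (0 : ℝ) := by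
      refine intervalIntegral.integral_congr fun s hs => ?_
      rw [uIcc_of_le hr] at hs
      exact hTz s (Or.inr hs.1)
    rw [h2, intervalIntegral.integral_zero] at h1
    linarith

/-! ### Capacity with respect to a prescribed volume ratio -/

section Capacity

variable {N : ℕ} {H : Euc N → ℝ} {w : Euc N → ℝ}

/-- Competitors for the capacity: the level set `{1 ≤ w}` occupies at least the fraction `ρ` of
the support. -/
structure IsCapacitary {N : ℕ} (ρ : ℝ) (w : Euc N → ℝ) : Prop where
  isCompactC1 : IsCompactC1 w
  suppVol_pos : 0 < suppVol w
  le_level : ρ * suppVol w ≤ volume.real {x | 1 ≤ w x}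

lemma IsCapacitary.mono {ρ ρ' : ℝ} (hw : IsCapacitary ρ w) (h : ρ' ≤ ρ) : IsCapacitary ρ' w :=
  ⟨hw.isCompactC1, hw.suppVol_pos,
    (mul_le_mul_of_nonneg_right h hw.suppVol_pos.le).trans hw.le_level⟩

lemma level_subset_tsupport {t : ℝ} (ht : 0 < t) : {x | t ≤ w x} ⊆ tsupport w := fun _ hx =>
  subset_tsupport w (ht.trans_le hx).ne'

lemma IsCompactC1.level_le_suppVol (hw : IsCompactC1 w) {t : ℝ} (ht : 0 < t) :
    volume.real {x | t ≤ w x} ≤ suppVol w :=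
  measureReal_mono (level_subset_tsupport ht) hw.tsupport_ne_top

lemma IsCompactC1.level_antitone (hw : IsCompactC1 w) {s t : ℝ} (hs : 0 < s) (hst : s ≤ t) :
    volume.real {x | t ≤ w x} ≤ volume.real {x | s ≤ w x} :=
  measureReal_mono (fun _ hx => hst.trans hx)
    ((measure_mono (level_subset_tsupport hs)).trans_lt hw.tsupport_ne_top.lt_top).ne

lemma pow_mul_le_finslerEnergy_of_level (hH : IsFinslerNorm N H) {ρ c t : ℝ} (hρ : 0 < ρ)
    (hc : ∀ v, IsCapacitary ρ v → c ≤ finslerEnergy H v) (hw : IsCompactC1 w) (ht : 0 < t)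
    (hpos : 0 < volume.real {x | t ≤ w x}) (hle : ρ * suppVol w ≤ volume.real {x | t ≤ w x}) :
    t ^ N * c ≤ finslerEnergy H w := by
  have hset : {x | 1 ≤ t⁻¹ * w x} = {x | t ≤ w x} := by
    ext x
    simp only [mem_ofPred_eq]
    rw [le_inv_mul_iff₀ ht, mul_one]
  have hw' := hw.const_mul t⁻¹
  have hsupp : suppVol (fun x => t⁻¹ * w x) ≤ suppVol w :=
    measureReal_mono (closure_mono fun x hx => right_ne_zero_of_mul hx) hw.tsupport_ne_top
  have hcap : IsCapacitary ρ (fun x => t⁻¹ * w x) := by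
    refine ⟨hw', ?_, ?_⟩
    · refine lt_of_lt_of_le hpos ?_
      rw [← hset]
      exact hw'.level_le_suppVol one_pos
    · rw [hset]
      exact (mul_le_mul_of_nonneg_left hsupp hρ.le).trans hle
  have h := hc _ hcap
  rw [finslerEnergy_const_mul hH hw, abs_of_pos (by positivity), inv_pow] at h
  rwa [le_inv_mul_iff₀ (by positivity)] at h

/-- The energy of a function between two of its levels controls the capacity. -/
lemma pow_mul_le_setIntegral_level (hH : IsFinslerNorm N H) (hN : N ≠ 0) {ρ c a b : ℝ}
    (hρ : 0 < ρ) (hc : ∀ v, IsCapacitary ρ v → c ≤ finslerEnergy H v) (hw : IsCompactC1 w)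
    (ha : 0 ≤ a) (hab : a < b) (hpos : 0 < volume.real {x | b ≤ w x})
    (hle : ρ * volume.real (tsupport w ∩ {x | a ≤ w x}) ≤ volume.real {x | b ≤ w x}) :
    (b - a) ^ N * c ≤ ∫ x in {x | w x ∈ Ioo a b}, H (gradient w x) ^ N := by
  have key : ∀ ε ∈ Ioo (0 : ℝ) (b - a),
      (b - a - ε) ^ N * c ≤ ∫ x in {x | w x ∈ Ioo a b}, H (gradient w x) ^ N := by
    intro ε hε
    obtain ⟨F, hF⟩ := exists_isProfile hab hε.1
    have hv := hw.comp_real hF.contDiff (hF.eq_zero 0 ha)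
    have hlev : {x | b ≤ w x} ⊆ {x | b - a - ε ≤ F (w x)} := fun x hx => by
      rw [mem_ofPred_eq, hF.eq_right _ hx]
      exact hF.sub_le b le_rfl
    have hpos' : 0 < b - a - ε := by linarith [hε.2]
    have hlev' : volume.real {x | b ≤ w x} ≤ volume.real {x | b - a - ε ≤ F (w x)} :=
      measureReal_mono hlev ((measure_mono (level_subset_tsupport hpos')).trans_lt
        hv.tsupport_ne_top.lt_top).ne
    have hsub : tsupport (fun x => F (w x)) ⊆ tsupport w ∩ {x | a ≤ w x} := by
      refine closure_minimal (fun x hx => ?_)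
        ((isClosed_tsupport w).inter (isClosed_le continuous_const hw.continuous))
      have hx1 : a < w x := by
        by_contra h
        exact hx (hF.eq_zero _ (not_lt.1 h))
      exact ⟨subset_tsupport w (ha.trans_lt hx1).ne', hx1.le⟩
    have hsupp : suppVol (fun x => F (w x)) ≤ volume.real (tsupport w ∩ {x | a ≤ w x}) :=
      measureReal_mono hsub ((measure_mono inter_subset_left).trans_lt
        hw.tsupport_ne_top.lt_top).ne
    have h := pow_mul_le_finslerEnergy_of_level hH hρ hc hv hpos' (hpos.trans_le hlev')
      (((mul_le_mul_of_nonneg_left hsupp hρ.le).trans hle).trans hlev')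
    refine h.trans ?_
    have hmeas : MeasurableSet {x | w x ∈ Ioo a b} :=
      (isOpen_Ioo.preimage hw.continuous).measurableSet
    rw [← integral_indicator hmeas]
    refine integral_mono (hv.integrable_energy hH hN)
      ((hw.integrable_energy hH hN).indicator hmeas) fun x => ?_
    dsimp only
    rw [gradient_comp_real (hF.differentiable (w x)).hasDerivAt (hw.differentiable x),
      hH.map_smul, abs_of_nonneg (hF.deriv_nonneg _)]
    by_cases hx : x ∈ {x | w x ∈ Ioo a b}
    · rw [indicator_of_mem hx]
      refine pow_le_pow_left₀ (mul_nonneg (hF.deriv_nonneg _) (hH.nonneg _)) ?_ N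
      exact mul_le_of_le_one_left (hH.nonneg _) (hF.deriv_le_one _)
    · rw [indicator_of_notMem hx, hF.deriv_eq_zero, zero_mul, zero_pow hN]
      by_contra! h
      exact hx h
  have hlim : Tendsto (fun ε : ℝ => (b - a - ε) ^ N * c) (𝓝[>] 0) (𝓝 ((b - a - 0) ^ N * c)) :=
    Tendsto.mono_left (Continuous.tendsto (by fun_prop) 0) nhdsWithin_le_nhds
  rw [sub_zero] at hlim
  refine le_of_tendsto hlim ?_
  filter_upwards [Ioo_mem_nhdsGT (sub_pos.2 hab)] with ε hε using key ε hε

/-- Splitting a function at an intermediate level. -/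
lemma exists_split_level (hH : IsFinslerNorm N H) (hN : N ≠ 0) {ρ₁ ρ₂ c₁ c₂ : ℝ}
    (hρ₁ : 0 < ρ₁) (hρ₂ : 0 < ρ₂)
    (hc₁ : ∀ v, IsCapacitary ρ₁ v → c₁ ≤ finslerEnergy H v)
    (hc₂ : ∀ v, IsCapacitary ρ₂ v → c₂ ≤ finslerEnergy H v) (hw : IsCapacitary (ρ₁ * ρ₂) w) :
    ∃ t ∈ Icc (0 : ℝ) 1, t ^ N * c₁ + (1 - t) ^ N * c₂ ≤ finslerEnergy H w := by
  have hwC := hw.isCompactC1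
  have hV := hw.suppVol_pos
  set S : Set ℝ := {s | s = 0 ∨ (0 < s ∧ s ≤ 1 ∧ ρ₁ * suppVol w ≤ volume.real {x | s ≤ w x})}
    with hS
  have hSb : BddAbove S := ⟨1, by
    rintro s (rfl | ⟨-, h, -⟩)
    · exact zero_le_one
    · exact h⟩
  have h0S : (0 : ℝ) ∈ S := Or.inl rfl
  set t := sSup S with ht
  have ht0 : 0 ≤ t := le_csSup hSb h0S
  have ht1 : t ≤ 1 := csSup_le ⟨0, h0S⟩ (by
    rintro s (rfl | ⟨-, h, -⟩)
    · exact zero_le_one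
    · exact h)
  refine ⟨t, ⟨ht0, ht1⟩, ?_⟩
  set I : ℝ → ℝ → ℝ := fun a b => ∫ x in {x | w x ∈ Ioo a b}, H (gradient w x) ^ N with hI
  have hI0 (a b : ℝ) : 0 ≤ I a b := integral_nonneg fun x => pow_nonneg (hH.nonneg _) _
  have h1 : ∀ s, 0 < s → s < t → s ^ N * c₁ ≤ I 0 s := by
    intro s hs hst
    obtain ⟨s', hs'S, hss'⟩ := exists_lt_of_lt_csSup ⟨0, h0S⟩ hst
    rcases hs'S with rfl | ⟨hs'0, hs'1, hs'⟩
    · linarith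
    have h2 := hs'.trans (hwC.level_antitone hs hss'.le)
    have h3 := pow_mul_le_setIntegral_level hH hN hρ₁ hc₁ hwC le_rfl hs
      (lt_of_lt_of_le (by positivity) h2)
      ((mul_le_mul_of_nonneg_left (measureReal_mono inter_subset_left hwC.tsupport_ne_top)
        hρ₁.le).trans h2)
    rwa [sub_zero] at h3
  have h2 : ∀ s, t < s → s < 1 → (1 - s) ^ N * c₂ ≤ I s 1 := by
    intro s hts hs1
    have hs0 : 0 < s := ht0.trans_lt hts
    have hns : s ∉ S := fun h => (le_csSup hSb h).not_gt hts
    have h3 : volume.real {x | s ≤ w x} < ρ₁ * suppVol w := by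
      by_contra! h
      exact hns (Or.inr ⟨hs0, hs1.le, h⟩)
    have h4 : volume.real (tsupport w ∩ {x | s ≤ w x}) ≤ ρ₁ * suppVol w :=
      (measureReal_mono inter_subset_right ((measure_mono (level_subset_tsupport hs0)).trans_lt
        hwC.tsupport_ne_top.lt_top).ne).trans h3.le
    refine pow_mul_le_setIntegral_level hH hN hρ₂ hc₂ hwC hs0.le hs1
      (lt_of_lt_of_le (by positivity) hw.le_level) (le_trans ?_ hw.le_level)
    calc _ ≤ ρ₂ * (ρ₁ * suppVol w) := by gcongr
      _ = _ := by ring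
  have key : ∀ η : ℝ, 0 < η →
      (max 0 (t - η)) ^ N * c₁ + (1 - min 1 (t + η)) ^ N * c₂ ≤ finslerEnergy H w := by
    intro η hη
    set s₁ := max 0 (t - η) with hs₁
    set s₂ := min 1 (t + η) with hs₂
    have hs₁t : s₁ ≤ t := max_le ht0 (by linarith)
    have hs₂t : t ≤ s₂ := le_min ht1 (by linarith)
    have e1 : s₁ ^ N * c₁ ≤ I 0 s₁ := by
      rcases le_total (t - η) 0 with h | h
      · rw [hs₁, max_eq_left h, zero_pow hN, zero_mul]
        exact hI0 _ _
      · rcases (le_max_left 0 (t - η)).eq_or_lt with h' | h'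
        · rw [hs₁, ← h', zero_pow hN, zero_mul]
          exact hI0 _ _
        · refine h1 _ h' ?_
          rw [hs₁, max_eq_right h]
          linarith
    have e2 : (1 - s₂) ^ N * c₂ ≤ I s₂ 1 := by
      rcases le_total 1 (t + η) with h | h
      · rw [hs₂, min_eq_left h, sub_self, zero_pow hN, zero_mul]
        exact hI0 _ _
      · rcases h.eq_or_lt with h' | h'
        · rw [hs₂, h', min_self, sub_self, zero_pow hN, zero_mul]
          exact hI0 _ _
        · rw [hs₂, min_eq_right h]
          exact h2 _ (by linarith) h'
    have hint := hwC.integrable_energy hH hN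
    have hdisj : Disjoint {x | w x ∈ Ioo 0 s₁} {x | w x ∈ Ioo s₂ 1} := by
      rw [Set.disjoint_left]
      intro x hx hx'
      linarith [hx.2, hx'.1]
    calc _ ≤ I 0 s₁ + I s₂ 1 := add_le_add e1 e2
      _ = ∫ x in {x | w x ∈ Ioo 0 s₁} ∪ {x | w x ∈ Ioo s₂ 1}, H (gradient w x) ^ N :=
        (setIntegral_union hdisj (isOpen_Ioo.preimage hwC.continuous).measurableSet
          hint.integrableOn hint.integrableOn).symm
      _ ≤ _ := setIntegral_le_integral hint
        (Eventually.of_forall fun x => pow_nonneg (hH.nonneg _) _)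
  have hlim : Tendsto (fun η : ℝ => (max 0 (t - η)) ^ N * c₁ + (1 - min 1 (t + η)) ^ N * c₂)
      (𝓝[>] 0) (𝓝 ((max 0 (t - 0)) ^ N * c₁ + (1 - min 1 (t + 0)) ^ N * c₂)) :=
    Tendsto.mono_left (Continuous.tendsto (by fun_prop) 0) nhdsWithin_le_nhds
  rw [sub_zero, add_zero, max_eq_right ht0, min_eq_right ht1] at hlim
  refine le_of_tendsto hlim ?_
  filter_upwards [self_mem_nhdsWithin] with η hη using key η hη

end Capacity

/-! ### Asymptotics of the capacity -/

section CapacityAsymptotics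

variable {N : ℕ} {H : Euc N → ℝ} {w : Euc N → ℝ}

/-- The capacity associated with the volume ratio `ρ`. -/
def capacity {N : ℕ} (H : Euc N → ℝ) (ρ : ℝ) : ℝ :=
  sInf (finslerEnergy H '' {w | IsCapacitary ρ w})

lemma IsCapacitary.capacity_le (hH : IsFinslerNorm N H) {ρ : ℝ} (hw : IsCapacitary ρ w) :
    capacity H ρ ≤ finslerEnergy H w :=
  csInf_le ⟨0, by rintro _ ⟨v, -, rfl⟩; exact finslerEnergy_nonneg hH v⟩ ⟨w, hw, rfl⟩

lemma volume_closedBall_pos {r : ℝ} (hr : 0 < r) :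
    0 < volume.real (Metric.closedBall (0 : Euc N) r) := by
  rw [measureReal_def]
  exact ENNReal.toReal_pos (Metric.measure_closedBall_pos _ _ hr).ne'
    (isCompact_closedBall _ _).measure_lt_top.ne

lemma isCapacitary_of_ball {w : Euc N → ℝ} (hw : IsCompactC1 w) {r ρ : ℝ} (hr : 0 < r)
    (hsub : tsupport w ⊆ Metric.closedBall 0 1)
    (hlev : ∀ x ∈ Metric.closedBall (0 : Euc N) r, 1 ≤ w x) (hρ : ρ ≤ r ^ N) :
    IsCapacitary ρ w := by
  have h1 : volume.real (Metric.closedBall (0 : Euc N) r) ≤ volume.real {x | 1 ≤ w x} :=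
    measureReal_mono hlev ((measure_mono (level_subset_tsupport one_pos)).trans_lt
      hw.tsupport_ne_top.lt_top).ne
  refine ⟨hw, (volume_closedBall_pos hr).trans_le (h1.trans (hw.level_le_suppVol one_pos)),
    le_trans ?_ h1⟩
  rw [Measure.addHaar_real_closedBall' _ _ hr.le, finrank_euclideanSpace_fin]
  have h2 : suppVol w ≤ volume.real (Metric.closedBall (0 : Euc N) 1) :=
    measureReal_mono hsub (isCompact_closedBall _ _).measure_lt_top.ne
  exact mul_le_mul hρ h2 (suppVol_nonneg w) (by positivity)

lemma exists_isCapacitary (hN : N ≠ 0) {ρ : ℝ} (hρ0 : 0 < ρ) (hρ : ρ < 1) :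
    ∃ w : Euc N → ℝ, IsCapacitary ρ w := by
  set r := ρ ^ (1 / (N : ℝ)) with hr
  have hr0 : 0 < r := by positivity
  have hr1 : r < 1 := Real.rpow_lt_one hρ0.le hρ (by positivity)
  have hrN : r ^ N = ρ := by rw [hr, one_div, Real.rpow_inv_natCast_pow hρ0.le hN]
  let χ : ContDiffBump (0 : Euc N) := ⟨r, 1, hr0, hr1⟩
  refine ⟨χ, isCapacitary_of_ball ⟨χ.contDiff, χ.hasCompactSupport⟩ hr0 χ.tsupport_eq.le
    (fun x hx => (χ.one_of_mem_closedBall hx).ge) hrN.ge⟩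

lemma le_capacity (hN : N ≠ 0) {ρ c : ℝ} (hρ0 : 0 < ρ) (hρ : ρ < 1)
    (h : ∀ w : Euc N → ℝ, IsCapacitary ρ w → c ≤ finslerEnergy H w) : c ≤ capacity H ρ := by
  obtain ⟨w, hw⟩ := exists_isCapacitary hN hρ0 hρ
  exact le_csInf ⟨_, w, hw, rfl⟩ (by rintro _ ⟨v, hv, rfl⟩; exact h v hv)

lemma capacity_pos (hN : 2 ≤ N) (hH : IsFinslerNorm N H) {ρ : ℝ} (hρ0 : 0 < ρ) (hρ : ρ < 1) :
    0 < capacity H ρ := by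
  obtain ⟨S, hS, hSob⟩ := exists_sobolev hN hH (le_refl 1)
  refine lt_of_lt_of_le (div_pos hρ0 hS) (le_capacity (by omega) hρ0 hρ fun w hw => ?_)
  have h1 := hSob w hw.isCompactC1
  simp only [mul_one, pow_one] at h1
  have hint : Integrable (fun x => |w x| ^ N) := by
    simpa using hw.isCompactC1.integrable_rpow (q := N) (by positivity)
  have h2 : volume.real {x | 1 ≤ w x} ≤ ∫ x, |w x| ^ N := by
    have hm : MeasurableSet {x | 1 ≤ w x} :=
      (isClosed_le continuous_const hw.isCompactC1.continuous).measurableSet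
    rw [← integral_indicator_one hm]
    refine integral_mono_of_nonneg (Eventually.of_forall fun x =>
      indicator_nonneg (fun _ _ => zero_le_one) _) hint (Eventually.of_forall fun x => ?_)
    dsimp only
    by_cases hx : x ∈ {x | 1 ≤ w x}
    · rw [indicator_of_mem hx]
      exact one_le_pow₀ (le_trans hx (le_abs_self _))
    · rw [indicator_of_notMem hx]
      positivity
  rw [div_le_iff₀ hS]
  have h3 := (hw.le_level.trans h2).trans h1
  refine le_of_mul_le_mul_right ?_ hw.suppVol_pos
  linarith

/-- The normalization of the capacity which is subadditive with respect to products of ratios. -/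
def capacityRoot {N : ℕ} (H : Euc N → ℝ) (ρ : ℝ) : ℝ :=
  capacity H ρ ^ (-(1 / ((N : ℝ) - 1)))

lemma capacityRoot_pos (hN : 2 ≤ N) (hH : IsFinslerNorm N H) {ρ : ℝ} (hρ0 : 0 < ρ) (hρ : ρ < 1) :
    0 < capacityRoot H ρ :=
  Real.rpow_pos_of_pos (capacity_pos hN hH hρ0 hρ) _

lemma capacityRoot_pow (hN : 2 ≤ N) (hH : IsFinslerNorm N H) {ρ : ℝ} (hρ0 : 0 < ρ) (hρ : ρ < 1) :
    capacityRoot H ρ ^ (N - 1) = (capacity H ρ)⁻¹ := by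
  have h := capacity_pos hN hH hρ0 hρ
  have hN1 : (0 : ℝ) < (N : ℝ) - 1 := by
    have : (2 : ℝ) ≤ N := by exact_mod_cast hN
    linarith
  rw [capacityRoot, ← Real.rpow_natCast, ← Real.rpow_mul h.le, Nat.cast_sub (by omega),
    Nat.cast_one, neg_mul, one_div, inv_mul_cancel₀ hN1.ne', Real.rpow_neg_one]

lemma capacityRoot_le_of_le_capacity (hN : 2 ≤ N) (hH : IsFinslerNorm N H) {ρ g : ℝ}
    (hρ0 : 0 < ρ) (hρ : ρ < 1) (hg : 0 < g) (h : (g ^ (N - 1))⁻¹ ≤ capacity H ρ) :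
    capacityRoot H ρ ≤ g := by
  refine le_of_pow_le_pow_left₀ (by omega : N - 1 ≠ 0) hg.le ?_
  rw [capacityRoot_pow hN hH hρ0 hρ]
  exact inv_le_of_inv_le₀ (by positivity) h

lemma le_capacityRoot_of_capacity_le (hN : 2 ≤ N) (hH : IsFinslerNorm N H) {ρ g : ℝ}
    (hρ0 : 0 < ρ) (hρ : ρ < 1) (h : capacity H ρ ≤ (g ^ (N - 1))⁻¹) :
    g ≤ capacityRoot H ρ := by
  refine le_of_pow_le_pow_left₀ (by omega : N - 1 ≠ 0) (capacityRoot_pos hN hH hρ0 hρ).le ?_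
  rw [capacityRoot_pow hN hH hρ0 hρ]
  exact le_inv_of_le_inv₀ (capacity_pos hN hH hρ0 hρ) h

lemma capacityRoot_mul_le (hN : 2 ≤ N) (hH : IsFinslerNorm N H) {ρ₁ ρ₂ : ℝ}
    (h₁ : 0 < ρ₁) (h₁' : ρ₁ < 1) (h₂ : 0 < ρ₂) (h₂' : ρ₂ < 1) :
    capacityRoot H (ρ₁ * ρ₂) ≤ capacityRoot H ρ₁ + capacityRoot H ρ₂ := by
  have hg₁ := capacityRoot_pos hN hH h₁ h₁'
  have hg₂ := capacityRoot_pos hN hH h₂ h₂'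
  have h12 : ρ₁ * ρ₂ < 1 := mul_lt_one_of_nonneg_of_lt_one_left h₁.le h₁' h₂'.le
  refine capacityRoot_le_of_le_capacity hN hH (mul_pos h₁ h₂) h12 (add_pos hg₁ hg₂) ?_
  refine le_capacity (by omega) (mul_pos h₁ h₂) h12 fun w hw => ?_
  obtain ⟨t, ⟨ht0, ht1⟩, ht⟩ := exists_split_level hH (by omega : N ≠ 0) h₁ h₂
    (fun v hv => hv.capacity_le hH) (fun v hv => hv.capacity_le hH) hw
  refine le_trans ?_ ht
  have h := add_pow_le_weighted (by omega : 1 ≤ N) ht0 (sub_nonneg.2 ht1) hg₁ hg₂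
  rw [add_sub_cancel, one_pow, capacityRoot_pow hN hH h₁ h₁', capacityRoot_pow hN hH h₂ h₂',
    div_inv_eq_mul, div_inv_eq_mul] at h
  rwa [inv_le_iff_one_le_mul₀' (by positivity)]

lemma capacityRoot_antitone (hN : 2 ≤ N) (hH : IsFinslerNorm N H) {ρ ρ' : ℝ}
    (hρ0 : 0 < ρ) (hρρ' : ρ ≤ ρ') (hρ' : ρ' < 1) : capacityRoot H ρ' ≤ capacityRoot H ρ := by
  have hρ := hρρ'.trans_lt hρ'
  refine capacityRoot_le_of_le_capacity hN hH (hρ0.trans_le hρρ') hρ'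
    (capacityRoot_pos hN hH hρ0 hρ) ?_
  rw [capacityRoot_pow hN hH hρ0 hρ, inv_inv]
  exact le_capacity (by omega) (hρ0.trans_le hρρ') hρ' fun w hw => (hw.mono hρρ').capacity_le hH

lemma pow_sum_le_sum_pow (hH : IsFinslerNorm N H) (hN : N ≠ 0) {ι : Type*} (s : Finset ι)
    (v : ι → Euc N) (h : ∀ i ∈ s, ∀ j ∈ s, v i ≠ 0 → v j ≠ 0 → i = j) :
    H (∑ i ∈ s, v i) ^ N ≤ ∑ i ∈ s, H (v i) ^ N := by
  by_cases hz : ∃ j ∈ s, v j ≠ 0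
  · obtain ⟨j, hj, hvj⟩ := hz
    rw [Finset.sum_eq_single_of_mem j hj fun i hi hij => by
      by_contra hvi
      exact hij (h i hi j hj hvi hvj)]
    exact Finset.single_le_sum (f := fun i => H (v i) ^ N)
      (fun i _ => pow_nonneg (hH.nonneg _) _) hj
  · push Not at hz
    rw [Finset.sum_eq_zero hz, hH.map_zero, zero_pow hN]
    exact Finset.sum_nonneg fun i _ => pow_nonneg (hH.nonneg _) _

/-- Logarithmic upper bound for the capacity, from a sum of rescaled cutoffs. -/
lemma exists_capacity_le (hN : 2 ≤ N) (hH : IsFinslerNorm N H) :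
    ∃ D : ℝ, 0 < D ∧ ∀ m : ℕ, m ≠ 0 →
      capacity H (((4 : ℝ)⁻¹ ^ m) ^ N) ≤ D * ((m : ℝ) ^ (N - 1))⁻¹ := by
  have hN0 : N ≠ 0 := by omega
  let χ : ContDiffBump (0 : Euc N) := ⟨1 / 2, 1, by norm_num, by norm_num⟩
  have hχ : IsCompactC1 χ := ⟨χ.contDiff, χ.hasCompactSupport⟩
  set e := finslerEnergy H χ with he
  have he0 : 0 ≤ e := finslerEnergy_nonneg hH _
  refine ⟨e + 1, by positivity, fun m hm => ?_⟩
  have hm0 : (0 : ℝ) < m := by positivity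
  have hgrad (x : Euc N) (hx : gradient χ x ≠ 0) : 1 / 2 ≤ ‖x‖ ∧ ‖x‖ ≤ 1 := by
    constructor
    · by_contra! h
      have h1 : (χ : Euc N → ℝ) =ᶠ[𝓝 x] fun _ => 1 :=
        χ.eventuallyEq_one_of_mem_ball (mem_ball_zero_iff.2 h)
      exact hx (h1.gradient_eq.trans (gradient_fun_const x (1 : ℝ)))
    · by_contra! h
      refine hx (gradient_eq_zero_of_notMem_tsupport ?_)
      rw [χ.tsupport_eq, mem_closedBall_zero_iff]
      exact not_le.2 h
  set v : ℕ → Euc N → ℝ := fun j x => (m : ℝ)⁻¹ * χ ((4 : ℝ) ^ j • x + 0) with hv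
  have hvC (j : ℕ) : IsCompactC1 (v j) :=
    (hχ.comp_affine (k := (4 : ℝ) ^ j) (by positivity) 0).const_mul _
  have hve (j : ℕ) : finslerEnergy H (v j) = ((m : ℝ)⁻¹) ^ N * e := by
    rw [finslerEnergy_const_mul hH (hχ.comp_affine (by positivity) 0),
      finslerEnergy_comp_affine hH hχ (by positivity), abs_of_pos (by positivity)]
  have hvg (j : ℕ) (x : Euc N) (hx : gradient (v j) x ≠ 0) :
      1 / 2 ≤ (4 : ℝ) ^ j * ‖x‖ ∧ (4 : ℝ) ^ j * ‖x‖ ≤ 1 := by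
    have h1 : gradient (v j) x
        = (m : ℝ)⁻¹ • (4 : ℝ) ^ j • gradient χ ((4 : ℝ) ^ j • x + 0) := by
      rw [hv, gradient_const_mul _ ((hχ.comp_affine (by positivity) 0).differentiable x),
        gradient_comp_affine _ _ hχ.differentiable]
    have h2 := hgrad ((4 : ℝ) ^ j • x + 0) fun h => hx (by rw [h1, h, smul_zero, smul_zero])
    rwa [add_zero, norm_smul, Real.norm_of_nonneg (by positivity)] at h2
  set φ : Euc N → ℝ := fun x => ∑ j ∈ Finset.range m, v j x with hφ
  have hφsub : Function.support φ ⊆ Metric.closedBall 0 1 := by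
    intro x hx
    obtain ⟨j, -, hj⟩ := Finset.exists_ne_zero_of_sum_ne_zero hx
    have h1 : (4 : ℝ) ^ j • x + 0 ∈ tsupport χ := subset_tsupport χ (right_ne_zero_of_mul hj)
    rw [χ.tsupport_eq, add_zero, mem_closedBall_zero_iff, norm_smul,
      Real.norm_of_nonneg (by positivity)] at h1
    rw [mem_closedBall_zero_iff]
    have h2 : (1 : ℝ) ≤ 4 ^ j := one_le_pow₀ (by norm_num)
    have h3 : (4 : ℝ) ^ j * ‖x‖ ≤ 1 := h1
    nlinarith [norm_nonneg x]
  have hφsub' : tsupport φ ⊆ Metric.closedBall 0 1 :=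
    closure_minimal hφsub Metric.isClosed_closedBall
  have hφC : IsCompactC1 φ :=
    ⟨ContDiff.sum fun j _ => (hvC j).contDiff,
      (isCompact_closedBall _ _).of_isClosed_subset (isClosed_tsupport _) hφsub'⟩
  have hcap : IsCapacitary (((4 : ℝ)⁻¹ ^ m) ^ N) φ := by
    refine isCapacitary_of_ball hφC (r := (4 : ℝ)⁻¹ ^ m) (by positivity) hφsub'
      (fun x hx => ?_) le_rfl
    have h1 : ∀ j ∈ Finset.range m, v j x = (m : ℝ)⁻¹ := by
      intro j hj
      have : χ ((4 : ℝ) ^ j • x + 0) = 1 := by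
        refine χ.one_of_mem_closedBall ?_
        rw [mem_closedBall_zero_iff] at hx
        rw [add_zero, mem_closedBall_zero_iff, norm_smul, Real.norm_of_nonneg (by positivity)]
        calc (4 : ℝ) ^ j * ‖x‖ ≤ (4 : ℝ) ^ j * (4 : ℝ)⁻¹ ^ m := by gcongr
          _ ≤ (4 : ℝ) ^ j * (4 : ℝ)⁻¹ ^ (j + 1) := by
            refine mul_le_mul_of_nonneg_left ?_ (by positivity)
            exact pow_le_pow_of_le_one (by norm_num) (by norm_num) (Finset.mem_range.1 hj)
          _ = (4 : ℝ)⁻¹ := by rw [pow_succ, inv_pow]; field_simp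
          _ ≤ 1 / 2 := by norm_num
      rw [hv]
      simp only [this, mul_one]
    rw [hφ]
    simp only
    rw [Finset.sum_congr rfl h1, Finset.sum_const, Finset.card_range, nsmul_eq_mul,
      mul_inv_cancel₀ hm0.ne']
  refine (hcap.capacity_le hH).trans ?_
  have h1 : finslerEnergy H φ ≤ ∑ j ∈ Finset.range m, finslerEnergy H (v j) := by
    unfold finslerEnergy
    rw [← integral_finsetSum _ fun j _ => (hvC j).integrable_energy hH hN0]
    refine integral_mono (hφC.integrable_energy hH hN0)
      (integrable_finsetSum _ fun j _ => (hvC j).integrable_energy hH hN0) fun x => ?_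
    dsimp only
    rw [hφ, gradient_sum _ fun j _ => (hvC j).differentiable x]
    refine pow_sum_le_sum_pow hH hN0 _ _ fun i _ j _ hi hj => ?_
    have hlt : ∀ i j : ℕ, gradient (v i) x ≠ 0 → gradient (v j) x ≠ 0 → ¬ i < j := by
      intro i j hi hj hij
      have h2 := (hvg i x hi).1
      have h3 := (hvg j x hj).2
      have h4 : (4 : ℝ) ^ (i + 1) ≤ 4 ^ j := pow_le_pow_right₀ (by norm_num) hij
      rw [pow_succ] at h4
      nlinarith [norm_nonneg x]
    exact le_antisymm (not_lt.1 (hlt j i hj hi)) (not_lt.1 (hlt i j hi hj))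
  refine h1.trans ?_
  simp_rw [hve]
  rw [Finset.sum_const, Finset.card_range, nsmul_eq_mul]
  have h2 : (m : ℝ) * ((m : ℝ)⁻¹ ^ N * e) = e * ((m : ℝ) ^ (N - 1))⁻¹ := by
    obtain ⟨n, rfl⟩ := Nat.exists_eq_add_of_le' (by omega : 1 ≤ N)
    rw [Nat.add_sub_cancel, pow_succ, inv_pow]
    field_simp
  rw [h2]
  gcongr
  linarith

/-- The capacity of the ratio `exp (-L)` is asymptotic to a multiple of `L ^ (1 - N)`. -/
lemma exists_tendsto_capacity (hN : 2 ≤ N) (hH : IsFinslerNorm N H) :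
    ∃ ℓ : ℝ, 0 < ℓ ∧
      Tendsto (fun L => capacity H (Real.exp (-L)) * (ℓ * L) ^ (N - 1)) atTop (𝓝 1) := by
  have hexp {x : ℝ} (hx : 0 < x) : Real.exp (-x) < 1 := Real.exp_lt_one_iff.2 (by linarith)
  set f : ℕ → ℝ := fun n => if n = 0 then 0 else capacityRoot H (Real.exp (-n)) with hf
  have hf0 {n : ℕ} (hn : n ≠ 0) : f n = capacityRoot H (Real.exp (-n)) := if_neg hn
  have hcast {n : ℕ} (hn : n ≠ 0) : (0 : ℝ) < n := by positivity
  have hfnn (n : ℕ) : 0 ≤ f n := by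
    by_cases hn : n = 0
    · simp [hf, hn]
    · rw [hf0 hn]
      exact (capacityRoot_pos hN hH (Real.exp_pos _) (hexp (hcast hn))).le
  have hsub : Subadditive f := by
    intro m n
    by_cases hm : m = 0
    · simp [hm, hf]
    by_cases hn : n = 0
    · simp [hn, hf]
    rw [hf0 hm, hf0 hn, hf0 (by omega), Nat.cast_add, neg_add, Real.exp_add]
    exact capacityRoot_mul_le hN hH (Real.exp_pos _) (hexp (hcast hm)) (Real.exp_pos _)
      (hexp (hcast hn))
  have hbdd : BddBelow (range fun n : ℕ => f n / n) :=
    ⟨0, by rintro _ ⟨n, rfl⟩; exact div_nonneg (hfnn n) n.cast_nonneg⟩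
  have hlim := hsub.tendsto_lim hbdd
  set ℓ := hsub.lim with hℓ
  have hℓ0 : 0 < ℓ := by
    obtain ⟨D, hD, hDm⟩ := exists_capacity_le hN hH
    have hN1 : (0 : ℝ) < (N : ℝ) - 1 := by
      have : (2 : ℝ) ≤ N := by exact_mod_cast hN
      linarith
    obtain ⟨d, hd, hdD⟩ : ∃ d : ℝ, 0 < d ∧ d ^ (N - 1) = D⁻¹ :=
      ⟨D⁻¹ ^ (((N - 1 : ℕ) : ℝ)⁻¹), by positivity,
        Real.rpow_inv_natCast_pow (by positivity) (by omega)⟩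
    have hsubseq : Tendsto (fun m : ℕ => 2 * N * m) atTop atTop :=
      tendsto_id.const_mul_atTop' (by omega)
    have h1 := hlim.comp hsubseq
    refine lt_of_lt_of_le (show 0 < d / (2 * N) by positivity) (ge_of_tendsto h1 ?_)
    filter_upwards [eventually_ne_atTop 0] with m hm
    have hm0 : (0 : ℝ) < m := hcast hm
    have hn : 2 * N * m ≠ 0 := by positivity
    simp only [Function.comp_apply]
    rw [hf0 hn]
    push_cast
    have h2 : d * m ≤ capacityRoot H (((4 : ℝ)⁻¹ ^ m) ^ N) := by
      refine le_capacityRoot_of_capacity_le hN hH (by positivity) ?_ ?_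
      · rw [← pow_mul]
        exact pow_lt_one₀ (by norm_num) (by norm_num) (by positivity)
      · rw [mul_pow, hdD, mul_inv, inv_inv]
        exact hDm m hm
    have h3 : Real.exp (-(2 * N * m)) ≤ ((4 : ℝ)⁻¹ ^ m) ^ N := by
      rw [← pow_mul, ← Real.exp_log (by norm_num : (0 : ℝ) < 4⁻¹), ← Real.exp_nat_mul,
        Real.log_inv]
      refine Real.exp_le_exp.2 ?_
      push_cast
      have h4 : Real.log 4 ≤ 2 := by
        rw [show (4 : ℝ) = 2 ^ 2 by norm_num, Real.log_pow]
        have := Real.log_two_lt_d9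
        push_cast
        linarith
      have : 0 ≤ (m : ℝ) * N := by positivity
      nlinarith
    have h4 := h2.trans (capacityRoot_antitone hN hH (Real.exp_pos _) h3 (by
      rw [← pow_mul]
      exact pow_lt_one₀ (by norm_num) (by norm_num) (by positivity)))
    rw [div_le_div_iff₀ (by positivity) (by positivity)]
    calc d * (2 * N * m) = (d * m) * (2 * N) := by ring
      _ ≤ _ := by gcongr
  have hroot : Tendsto (fun L => capacityRoot H (Real.exp (-L)) / L) atTop (𝓝 ℓ) := by
    have l1 := (hlim.comp tendsto_nat_floor_atTop).mul (tendsto_nat_floor_div_atTop (R := ℝ))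
    have l2 := (hlim.comp tendsto_nat_ceil_atTop).mul (tendsto_nat_ceil_div_atTop (R := ℝ))
    rw [mul_one] at l1 l2
    refine tendsto_of_tendsto_of_tendsto_of_le_of_le' l1 l2 ?_ ?_
    · filter_upwards [eventually_ge_atTop 1] with L hL
      have hn : ⌊L⌋₊ ≠ 0 := (Nat.floor_pos.2 hL).ne'
      simp only [Function.comp_apply]
      rw [hf0 hn, div_mul_div_cancel₀ (hcast hn).ne']
      gcongr
      exact capacityRoot_antitone hN hH (Real.exp_pos _)
        (Real.exp_le_exp.2 (neg_le_neg (Nat.floor_le (by linarith)))) (hexp (hcast hn))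
    · filter_upwards [eventually_ge_atTop 1] with L hL
      have hn : ⌈L⌉₊ ≠ 0 := (Nat.ceil_pos.2 (by linarith)).ne'
      simp only [Function.comp_apply]
      rw [hf0 hn, div_mul_div_cancel₀ (hcast hn).ne']
      gcongr
      exact capacityRoot_antitone hN hH (Real.exp_pos _)
        (Real.exp_le_exp.2 (neg_le_neg (Nat.le_ceil L))) (hexp (by linarith))
  refine ⟨ℓ, hℓ0, ?_⟩
  have h1 := ((hroot.div_const ℓ).inv₀ (by rw [div_self hℓ0.ne']; exact one_ne_zero)).pow (N - 1)
  rw [div_self hℓ0.ne', inv_one, one_pow] at h1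
  refine h1.congr' ?_
  filter_upwards [eventually_gt_atTop 0] with L hL
  have hr := capacityRoot_pos hN hH (Real.exp_pos _) (hexp hL)
  have h2 := capacityRoot_pow hN hH (Real.exp_pos _) (hexp hL)
  rw [inv_div, div_div_eq_mul_div, div_pow, h2, div_inv_eq_mul, mul_comm]

end CapacityAsymptotics

/-! ### Truncations of a least energy solution -/

section Solution

variable {N : ℕ} {H : Euc N → ℝ} {Ω : Set (Euc N)} {p : ℝ} {u : Euc N → ℝ}

lemma IsOpen.closure_mem_nhds (hΩ : IsOpen Ω) {x : Euc N} (hx : x ∈ Ω) : closure Ω ∈ 𝓝 x :=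
  mem_of_superset (hΩ.mem_nhds hx) subset_closure

/-- The gradient of a function which is `C¹` up to the boundary is bounded. -/
lemma exists_gradient_bound (hΩ : IsOpen Ω) (hΩb : Bornology.IsBounded Ω)
    (hu : ContDiffOn ℝ 1 u (closure Ω)) : ∃ G : ℝ, 0 ≤ G ∧ ∀ x ∈ Ω, ‖gradient u x‖ ≤ G := by
  have key : ∃ G : ℝ, ∀ x ∈ closure Ω ∩ Ω, ‖gradient u x‖ ≤ G := by
    refine IsCompact.induction_on (p := fun s => ∃ G : ℝ, ∀ x ∈ s ∩ Ω, ‖gradient u x‖ ≤ G)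
      hΩb.isCompact_closure ⟨0, by simp⟩ ?_ ?_ ?_
    · rintro s t hst ⟨G, hG⟩
      exact ⟨G, fun x hx => hG x ⟨hst hx.1, hx.2⟩⟩
    · rintro s t ⟨G, hG⟩ ⟨G', hG'⟩
      refine ⟨max G G', fun x hx => ?_⟩
      rcases hx.1 with h | h
      · exact (hG x ⟨h, hx.2⟩).trans (le_max_left _ _)
      · exact (hG' x ⟨h, hx.2⟩).trans (le_max_right _ _)
    · intro x hx
      have h1 : ContDiffWithinAt ℝ (0 + 1) u (closure Ω) x := by simpa using hu x hx
      obtain ⟨U, hU, -, f', hf', hc⟩ :=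
        (contDiffWithinAt_succ_iff_hasFDerivWithinAt (by simp)).1 h1
      rw [insert_eq_of_mem hx] at hU
      have hc' : ContinuousWithinAt f' U x := hc.continuousWithinAt
      have h2 : ∀ᶠ y in 𝓝[U] x, ‖f' y‖ < ‖f' x‖ + 1 :=
        hc'.norm.eventually_lt_const (by linarith)
      rw [eventually_nhdsWithin_iff] at h2
      obtain ⟨O, hOx, hO⟩ := mem_nhdsWithin_iff_exists_mem_nhds_inter.1 hU
      refine ⟨interior O ∩ {y | y ∈ U → ‖f' y‖ < ‖f' x‖ + 1}, ?_, ‖f' x‖ + 1, ?_⟩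
      · exact mem_nhdsWithin_of_mem_nhds (inter_mem (interior_mem_nhds.2 hOx) h2)
      · rintro y ⟨⟨hyO, hy⟩, hyΩ⟩
        have hUy : U ∈ 𝓝 y := by
          refine mem_of_superset (inter_mem (isOpen_interior.mem_nhds hyO) (hΩ.mem_nhds hyΩ)) ?_
          exact fun z hz => hO ⟨interior_subset hz.1, subset_closure hz.2⟩
        have hyU := mem_of_mem_nhds hUy
        rw [norm_gradient_eq, ((hf' y hyU).hasFDerivAt hUy).fderiv]
        exact (hy hyU).le
  obtain ⟨G, hG⟩ := key
  exact ⟨max G 0, le_max_right _ _, fun x hx =>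
    (hG x ⟨subset_closure hx, hx⟩).trans (le_max_left _ _)⟩

/-- The truncation of `u` by `F`, extended by zero outside `Ω`. -/
def truncation {N : ℕ} (Ω : Set (Euc N)) (F : ℝ → ℝ) (u : Euc N → ℝ) : Euc N → ℝ :=
  Ω.indicator fun x => F (u x)

namespace IsLeastEnergySolution

lemma continuousOn (hu : IsLeastEnergySolution N H Ω p u) : ContinuousOn u (closure Ω) :=
  hu.1.continuousOn

lemma bddAbove (hu : IsLeastEnergySolution N H Ω p u) (hΩb : Bornology.IsBounded Ω) :
    BddAbove (u '' Ω) :=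
  (hΩb.isCompact_closure.bddAbove_image hu.continuousOn).mono (image_mono subset_closure)

lemma le_sSup (hu : IsLeastEnergySolution N H Ω p u) (hΩb : Bornology.IsBounded Ω) {x : Euc N}
    (hx : x ∈ Ω) : u x ≤ sSup (u '' Ω) :=
  le_csSup (hu.bddAbove hΩb) (mem_image_of_mem _ hx)

lemma sSup_pos (hu : IsLeastEnergySolution N H Ω p u) (hΩb : Bornology.IsBounded Ω)
    (hΩne : Ω.Nonempty) : 0 < sSup (u '' Ω) := by
  obtain ⟨x, hx⟩ := hΩne
  exact (hu.2.1 x hx).trans_le (hu.le_sSup hΩb hx)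

lemma differentiableAt (hu : IsLeastEnergySolution N H Ω p u) (hΩ : IsOpen Ω) {x : Euc N}
    (hx : x ∈ Ω) : DifferentiableAt ℝ u x :=
  (hu.1.contDiffAt (hΩ.closure_mem_nhds hx)).differentiableAt one_ne_zero

lemma aestronglyMeasurable (hu : IsLeastEnergySolution N H Ω p u) (hΩ : IsOpen Ω) :
    AEStronglyMeasurable u (volume.restrict Ω) :=
  (hu.continuousOn.mono subset_closure).aestronglyMeasurable hΩ.measurableSet

lemma isOpen_superlevel (hu : IsLeastEnergySolution N H Ω p u) (hΩ : IsOpen Ω) (t : ℝ) :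
    IsOpen {x | x ∈ Ω ∧ t < u x} :=
  (hu.continuousOn.mono subset_closure).isOpen_inter_preimage hΩ isOpen_Ioi

variable {a b ε : ℝ} {F : ℝ → ℝ}

lemma tsupport_truncation_subset (hu : IsLeastEnergySolution N H Ω p u)
    (hF : IsProfile a b ε F) (ha : 0 < a) :
    tsupport (truncation Ω F u) ⊆ Ω := by
  have hK : IsClosed (closure Ω ∩ u ⁻¹' Ici a) :=
    hu.continuousOn.preimage_isClosed_of_isClosed isClosed_closure isClosed_Ici
  have h1 : tsupport (truncation Ω F u) ⊆ closure Ω ∩ u ⁻¹' Ici a := by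
    refine closure_minimal (fun x hx => ?_) hK
    have hxΩ : x ∈ Ω := mem_of_indicator_ne_zero hx
    refine ⟨subset_closure hxΩ, ?_⟩
    by_contra h
    refine hx ?_
    rw [truncation, indicator_of_mem hxΩ]
    exact hF.eq_zero _ (not_le.1 h).le
  intro x hx
  obtain ⟨hx1, hx2⟩ := h1 hx
  by_contra hxΩ
  have h2 : x ∈ frontier Ω := ⟨hx1, fun h => hxΩ (interior_subset h)⟩
  have h3 := hu.2.2.1 x h2
  rw [mem_preimage, h3, mem_Ici] at hx2
  linarith

lemma eventuallyEq_truncation (hΩ : IsOpen Ω) {x : Euc N} (hx : x ∈ Ω) :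
    truncation Ω F u =ᶠ[𝓝 x] fun y => F (u y) := by
  filter_upwards [hΩ.mem_nhds hx] with y hy
  exact indicator_of_mem hy _

lemma isCompactC1_truncation (hu : IsLeastEnergySolution N H Ω p u) (hΩ : IsOpen Ω)
    (hΩb : Bornology.IsBounded Ω) (hF : IsProfile a b ε F) (ha : 0 < a) :
    IsCompactC1 (truncation Ω F u) := by
  have hsub := hu.tsupport_truncation_subset hF ha
  refine ⟨contDiff_iff_contDiffAt.2 fun x => ?_, ?_⟩
  · by_cases hx : x ∈ tsupport (truncation Ω F u)
    · have h1 := hu.1.contDiffAt (hΩ.closure_mem_nhds (hsub hx))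
      exact (hF.contDiff.contDiffAt.comp x h1).congr_of_eventuallyEq
        (eventuallyEq_truncation hΩ (hsub hx))
    · exact contDiffAt_const.congr_of_eventuallyEq (notMem_tsupport_iff_eventuallyEq.1 hx)
  · exact hΩb.isCompact_closure.of_isClosed_subset (isClosed_tsupport _)
      (hsub.trans subset_closure)

lemma gradient_truncation (hu : IsLeastEnergySolution N H Ω p u) (hΩ : IsOpen Ω)
    (hF : IsProfile a b ε F) {x : Euc N} (hx : x ∈ Ω) :
    gradient (truncation Ω F u) x = deriv F (u x) • gradient u x := by
  rw [(eventuallyEq_truncation hΩ hx).gradient_eq,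
    gradient_comp_real (hF.differentiable _).hasDerivAt (hu.differentiableAt hΩ hx)]

lemma suppVol_truncation_le (hu : IsLeastEnergySolution N H Ω p u)
    (hΩb : Bornology.IsBounded Ω) (hF : IsProfile a b ε F) (ha : 0 < a) :
    suppVol (truncation Ω F u) ≤ volume.real Ω :=
  measureReal_mono (hu.tsupport_truncation_subset hF ha) hΩb.measure_lt_top.ne

lemma integrableOn_energy (hu : IsLeastEnergySolution N H Ω p u) (hH : IsFinslerNorm N H)
    (hΩ : IsOpen Ω) (hΩb : Bornology.IsBounded Ω) :
    IntegrableOn (fun x => H (gradient u x) ^ N) Ω := by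
  obtain ⟨G, hG0, hG⟩ := exists_gradient_bound hΩ hΩb hu.1
  obtain ⟨C, hC, hCH⟩ := hH.exists_le
  refine Measure.integrableOn_of_bounded (M := (C * G) ^ N) hΩb.measure_lt_top.ne
    ((hH.continuous.measurable.comp measurable_gradient).pow_const N).aestronglyMeasurable ?_
  filter_upwards [ae_restrict_mem hΩ.measurableSet] with x hx
  rw [Real.norm_of_nonneg (pow_nonneg (hH.nonneg _) _)]
  refine pow_le_pow_left₀ (hH.nonneg _) ((hCH _).trans ?_) _
  have := hG x hx
  gcongr

lemma integrableOn_comp (hu : IsLeastEnergySolution N H Ω p u)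
    (hΩb : Bornology.IsBounded Ω) {g : ℝ → ℝ} (hg : Continuous g) :
    IntegrableOn (fun x => g (u x)) Ω :=
  ((hg.comp_continuousOn hu.continuousOn).integrableOn_compact
    hΩb.isCompact_closure).mono_set subset_closure

/-- The weak formulation holds for compactly supported `C¹` test functions. -/
lemma integral_test (hu : IsLeastEnergySolution N H Ω p u) (hH : IsFinslerNorm N H)
    (hΩ : IsOpen Ω) (hΩb : Bornology.IsBounded Ω) (hp : 0 < p) {v : Euc N → ℝ}
    (hv : IsCompactC1 v) (hsub : tsupport v ⊆ Ω) :
    (∫ x in Ω, H (gradient u x) ^ (N - 1) * ⟪gradient H (gradient u x), gradient v x⟫)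
      = ∫ x in Ω, u x ^ p * v x := by
  choose φ h1 h2 h3 h4 using fun n : ℕ =>
    hv.exists_smooth_approx hΩ hsub (ε := 1 / ((n : ℝ) + 1)) (by positivity)
  have hfin : IsFiniteMeasure (volume.restrict Ω) :=
    ⟨by simpa using hΩb.measure_lt_top⟩
  have hle1 (n : ℕ) : 1 / ((n : ℝ) + 1) ≤ 1 := by
    rw [div_le_one (by positivity)]
    linarith [n.cast_nonneg (α := ℝ)]
  have hlim := tendsto_one_div_add_atTop_nhds_zero_nat (𝕜 := ℝ)
  have hφlim (x : Euc N) : Tendsto (fun n => φ n x) atTop (𝓝 (v x)) := by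
    rw [tendsto_iff_dist_tendsto_zero]
    exact squeeze_zero (fun n => dist_nonneg) (fun n => by rw [Real.dist_eq]; exact (h4 n x).1) hlim
  have hglim (x : Euc N) : Tendsto (fun n => gradient (φ n) x) atTop (𝓝 (gradient v x)) := by
    rw [tendsto_iff_dist_tendsto_zero]
    exact squeeze_zero (fun n => dist_nonneg) (fun n => by rw [dist_eq_norm]; exact (h4 n x).2) hlim
  obtain ⟨M, hM⟩ := hv.hasCompactSupport.exists_bound_of_continuous hv.continuous
  obtain ⟨G', hG'⟩ := (hasCompactSupport_gradient hv.hasCompactSupport).exists_bound_of_continuous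
    (continuous_gradient hv.contDiff)
  obtain ⟨G, hG0, hG⟩ := exists_gradient_bound hΩ hΩb hu.1
  obtain ⟨C, hC, hCH⟩ := hH.exists_le
  obtain ⟨Λ, hΛ⟩ := hH.exists_lipschitz
  have hup : AEStronglyMeasurable (fun x => u x ^ p) (volume.restrict Ω) :=
    (hu.integrableOn_comp hΩb (Real.continuous_rpow_const hp.le)).aestronglyMeasurable
  have l1 : Tendsto (fun n => ∫ x in Ω, u x ^ p * φ n x) atTop
      (𝓝 (∫ x in Ω, u x ^ p * v x)) := by
    refine tendsto_integral_of_dominated_convergence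
      (fun _ => sSup (u '' Ω) ^ p * (M + 1))
      (fun n => hup.mul (h1 n).continuous.aestronglyMeasurable) (integrable_const _)
      (fun n => ?_) (Eventually.of_forall fun x => (hφlim x).const_mul _)
    filter_upwards [ae_restrict_mem hΩ.measurableSet] with x hx
    have hx0 := (hu.2.1 x hx).le
    rw [norm_mul, Real.norm_of_nonneg (Real.rpow_nonneg hx0 _)]
    refine mul_le_mul (Real.rpow_le_rpow hx0 (hu.le_sSup hΩb hx) hp.le) ?_ (norm_nonneg _)
      (Real.rpow_nonneg (hx0.trans (hu.le_sSup hΩb hx)) _)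
    have := norm_sub_norm_le (φ n x) (v x)
    have h5 := (h4 n x).1
    rw [← Real.norm_eq_abs] at h5
    linarith [hle1 n, hM x]
  have l2 : Tendsto (fun n => ∫ x in Ω, H (gradient u x) ^ (N - 1) *
        ⟪gradient H (gradient u x), gradient (φ n) x⟫) atTop
      (𝓝 (∫ x in Ω, H (gradient u x) ^ (N - 1) *
        ⟪gradient H (gradient u x), gradient v x⟫)) := by
    refine tendsto_integral_of_dominated_convergence
      (fun _ => (C * G) ^ (N - 1) * (Λ * (G' + 1))) (fun n => ?_) (integrable_const _)
      (fun n => ?_) (Eventually.of_forall fun x =>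
        (Tendsto.inner tendsto_const_nhds (hglim x)).const_mul _)
    · refine Measurable.aestronglyMeasurable ?_
      exact ((hH.continuous.measurable.comp measurable_gradient).pow_const _).mul
        ((measurable_gradient.comp measurable_gradient).inner measurable_gradient)
    · filter_upwards [ae_restrict_mem hΩ.measurableSet] with x hx
      rw [norm_mul, Real.norm_of_nonneg (pow_nonneg (hH.nonneg _) _)]
      refine mul_le_mul (pow_le_pow_left₀ (hH.nonneg _) ((hCH _).trans ?_) _) ?_ (norm_nonneg _)
        (by positivity)
      · have := hG x hx
        gcongr
      · refine (norm_inner_le_norm _ _).trans (mul_le_mul ?_ ?_ (norm_nonneg _) Λ.coe_nonneg)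
        · rw [norm_gradient_eq]
          exact norm_fderiv_le_of_lipschitz ℝ hΛ
        · have := norm_sub_norm_le (gradient (φ n) x) (gradient v x)
          linarith [(h4 n x).2, hle1 n, hG' x]
  refine tendsto_nhds_unique l2 (l1.congr fun n => ?_)
  exact (hu.2.2.2.1 (φ n) (h1 n) (h2 n) (h3 n)).symm

lemma integral_deriv_mul (hu : IsLeastEnergySolution N H Ω p u) (hN : 2 ≤ N)
    (hH : IsFinslerNorm N H) (hreg : FinslerRegular N H) (hΩ : IsOpen Ω)
    (hΩb : Bornology.IsBounded Ω) (hp : 0 < p) (hF : IsProfile a b ε F) (ha : 0 < a) :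
    ∫ x in Ω, deriv F (u x) * H (gradient u x) ^ N = ∫ x in Ω, u x ^ p * F (u x) := by
  have h := hu.integral_test hH hΩ hΩb hp (hu.isCompactC1_truncation hΩ hΩb hF ha)
    (hu.tsupport_truncation_subset hF ha)
  have e1 : ∫ x in Ω, H (gradient u x) ^ (N - 1) *
      ⟪gradient H (gradient u x), gradient (truncation Ω F u) x⟫
      = ∫ x in Ω, deriv F (u x) * H (gradient u x) ^ N := by
    refine setIntegral_congr_fun hΩ.measurableSet fun x hx => ?_
    rw [hu.gradient_truncation hΩ hF hx, inner_smul_right]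
    by_cases h0 : gradient u x = 0
    · rw [h0, hH.map_zero, zero_pow (by omega), zero_pow (by omega), zero_mul, mul_zero]
    · rw [hH.inner_gradient_self hreg h0]
      obtain ⟨n, rfl⟩ := Nat.exists_eq_add_of_le' (by omega : 1 ≤ N)
      rw [Nat.add_sub_cancel, pow_succ]
      ring
  have e2 : ∫ x in Ω, u x ^ p * truncation Ω F u x = ∫ x in Ω, u x ^ p * F (u x) :=
    setIntegral_congr_fun hΩ.measurableSet fun x hx => by
      simp only [truncation, indicator_of_mem hx]
  rw [← e1, h, e2]

lemma finslerEnergy_truncation (hu : IsLeastEnergySolution N H Ω p u) (hN : N ≠ 0)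
    (hH : IsFinslerNorm N H) (hΩ : IsOpen Ω) (hF : IsProfile a b ε F) (ha : 0 < a) :
    finslerEnergy H (truncation Ω F u) = ∫ x in Ω, (deriv F (u x) * H (gradient u x)) ^ N := by
  have h1 : finslerEnergy H (truncation Ω F u)
      = ∫ x in Ω, H (gradient (truncation Ω F u) x) ^ N := by
    refine (setIntegral_eq_of_tsupport_subset fun x hx => ?_).symm
    rw [gradient_eq_zero_of_notMem_tsupport fun h =>
      hx (hu.tsupport_truncation_subset hF ha h), hH.map_zero, zero_pow hN]
  rw [h1]
  refine setIntegral_congr_fun hΩ.measurableSet fun x hx => ?_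
  rw [hu.gradient_truncation hΩ hF hx, hH.map_smul, abs_of_nonneg (hF.deriv_nonneg _)]

lemma integrableOn_deriv_mul (hu : IsLeastEnergySolution N H Ω p u)
    (hH : IsFinslerNorm N H) (hΩ : IsOpen Ω) (hΩb : Bornology.IsBounded Ω)
    (hF : IsProfile a b ε F) :
    IntegrableOn (fun x => deriv F (u x) * H (gradient u x) ^ N) Ω := by
  refine Integrable.bdd_mul (c := 1) (hu.integrableOn_energy hH hΩ hΩb)
    ((hF.contDiff.continuous_deriv le_rfl).comp_aestronglyMeasurable
      (hu.aestronglyMeasurable hΩ)) (Eventually.of_forall fun x => ?_)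
  rw [Real.norm_of_nonneg (hF.deriv_nonneg _)]
  exact hF.deriv_le_one _

lemma finslerEnergy_truncation_le (hu : IsLeastEnergySolution N H Ω p u) (hN : 2 ≤ N)
    (hH : IsFinslerNorm N H) (hreg : FinslerRegular N H) (hΩ : IsOpen Ω)
    (hΩb : Bornology.IsBounded Ω) (hp : 0 < p) (hF : IsProfile a b ε F) (ha : 0 < a) :
    finslerEnergy H (truncation Ω F u) ≤ ∫ x in Ω, u x ^ p * F (u x) := by
  rw [hu.finslerEnergy_truncation (by omega) hH hΩ hF ha,
    ← hu.integral_deriv_mul hN hH hreg hΩ hΩb hp hF ha]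
  refine integral_mono_of_nonneg (Eventually.of_forall fun x =>
    pow_nonneg (mul_nonneg (hF.deriv_nonneg _) (hH.nonneg _)) _)
    (hu.integrableOn_deriv_mul hH hΩ hΩb hF) (Eventually.of_forall fun x => ?_)
  dsimp only
  rw [mul_pow]
  exact mul_le_mul_of_nonneg_right
    (pow_le_of_le_one (hF.deriv_nonneg _) (hF.deriv_le_one _) (by omega))
    (pow_nonneg (hH.nonneg _) _)

lemma integral_mul_profile_le_energy (hu : IsLeastEnergySolution N H Ω p u) (hN : 2 ≤ N)
    (hH : IsFinslerNorm N H) (hreg : FinslerRegular N H) (hΩ : IsOpen Ω)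
    (hΩb : Bornology.IsBounded Ω) (hp : 0 < p) (hF : IsProfile a b ε F) (ha : 0 < a) :
    ∫ x in Ω, u x ^ p * F (u x) ≤ ∫ x in Ω, H (gradient u x) ^ N := by
  rw [← hu.integral_deriv_mul hN hH hreg hΩ hΩb hp hF ha]
  refine integral_mono (hu.integrableOn_deriv_mul hH hΩ hΩb hF)
    (hu.integrableOn_energy hH hΩ hΩb) fun x => ?_
  exact mul_le_of_le_one_left (pow_nonneg (hH.nonneg _) _) (hF.deriv_le_one _)

end IsLeastEnergySolution

end Solution

/-! ### Energy bounds and level set estimates for a least energy solution -/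

lemma le_apply_zero_of_eventually {c : ℝ} {f : ℝ → ℝ} (hf : Continuous f)
    (h : ∀ᶠ ε in 𝓝[>] (0 : ℝ), c ≤ f ε) : c ≤ f 0 :=
  ge_of_tendsto (hf.continuousAt.tendsto.mono_left nhdsWithin_le_nhds) h

/-- A positive sequence with superlinear recursion and a positive lower bound does not start
small. -/
lemma one_le_of_superlinear {Y : ℕ → ℝ} {C M m : ℝ} {n : ℕ} (hn : 1 ≤ n) (hM : 1 ≤ M)
    (hC : 0 < C) (hm : 0 < m) (hY : ∀ j, m ≤ Y j)
    (h : ∀ j, Y (j + 1) ≤ C * M ^ j * Y j ^ (n + 1)) : 1 ≤ C * M * Y 0 ^ n := by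
  have hM0 : 0 < M := by linarith
  have hY0 (j : ℕ) : 0 < Y j := hm.trans_le (hY j)
  set V : ℕ → ℝ := fun j => C * M * (M ^ j * Y j) ^ n with hV
  have hV0 (j : ℕ) : 0 < V j := by have := hY0 j; positivity
  have hstep (j : ℕ) : V (j + 1) ≤ V j ^ (n + 1) := by
    have h0 := hY0 j
    have h1 : M ^ (j + 1) * Y (j + 1) ≤ V j * (M ^ j * Y j) := by
      calc M ^ (j + 1) * Y (j + 1) ≤ M ^ (j + 1) * (C * M ^ j * Y j ^ (n + 1)) := by
            gcongr
            exact h j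
        _ = C * M * (M ^ j * Y j ^ n) * (M ^ j * Y j) := by ring
        _ ≤ C * M * ((M ^ j) ^ n * Y j ^ n) * (M ^ j * Y j) := by
            gcongr
            exact le_self_pow₀ (one_le_pow₀ hM) (by omega)
        _ = V j * (M ^ j * Y j) := by rw [hV]; ring
    calc V (j + 1) ≤ C * M * (V j * (M ^ j * Y j)) ^ n := by
          have := hY0 (j + 1)
          simp only [hV] at h1 ⊢
          gcongr
      _ = V j ^ n * V j := by rw [mul_pow]; simp only [hV]; ring
      _ = V j ^ (n + 1) := (pow_succ _ _).symm
  have hV00 : V 0 = C * M * Y 0 ^ n := by simp [hV]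
  rw [← hV00]
  by_contra! hlt
  have hdecay (j : ℕ) : V j ≤ V 0 ^ (j + 1) := by
    induction j with
    | zero => simp
    | succ j ih =>
      have h1 : V 0 ^ (j + 1) ≤ 1 := pow_le_one₀ (hV0 0).le hlt.le
      calc V (j + 1) ≤ V j ^ (n + 1) := hstep j
        _ ≤ (V 0 ^ (j + 1)) ^ (n + 1) := by have := (hV0 j).le; gcongr
        _ ≤ (V 0 ^ (j + 1)) ^ 2 :=
            pow_le_pow_of_le_one (pow_nonneg (hV0 0).le _) h1 (by omega)
        _ = V 0 ^ ((j + 1) * 2) := (pow_mul _ _ _).symm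
        _ ≤ V 0 ^ (j + 1 + 1) := pow_le_pow_of_le_one (hV0 0).le hlt.le (by omega)
  have hlim : Tendsto (fun j => V 0 ^ (j + 1)) atTop (𝓝 0) :=
    (tendsto_pow_atTop_nhds_zero_of_lt_one (hV0 0).le hlt).comp (tendsto_add_atTop_nat 1)
  have hlow : C * M * m ^ n ≤ 0 := by
    refine ge_of_tendsto' hlim fun j => le_trans ?_ (hdecay j)
    have h1 : m ≤ M ^ j * Y j := (hY j).trans (le_mul_of_one_le_left (hY0 j).le (one_le_pow₀ hM))
    simp only [hV]
    gcongr
  have : 0 < C * M * m ^ n := by positivity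
  linarith

section Solution

variable {N : ℕ} {H : Euc N → ℝ} {Ω : Set (Euc N)} {p : ℝ} {u : Euc N → ℝ}

namespace IsLeastEnergySolution

lemma integrableOn_rpow (hu : IsLeastEnergySolution N H Ω p u) (hΩb : Bornology.IsBounded Ω)
    {q : ℝ} (hq : 0 ≤ q) : IntegrableOn (fun x => u x ^ q) Ω :=
  hu.integrableOn_comp hΩb (Real.continuous_rpow_const hq)

lemma integrableOn_rpow_mul (hu : IsLeastEnergySolution N H Ω p u)
    (hΩb : Bornology.IsBounded Ω) {q : ℝ} (hq : 0 ≤ q) {F : ℝ → ℝ} (hF : Continuous F) :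
    IntegrableOn (fun x => u x ^ q * F (u x)) Ω :=
  hu.integrableOn_comp hΩb ((Real.continuous_rpow_const hq).mul hF)

lemma integral_rpow_pos (hu : IsLeastEnergySolution N H Ω p u) (hΩ : IsOpen Ω)
    (hΩb : Bornology.IsBounded Ω) (hΩne : Ω.Nonempty) {q : ℝ} (hq : 0 ≤ q) :
    0 < ∫ x in Ω, u x ^ q := by
  refine (setIntegral_pos_iff_support_of_nonneg_ae ?_ (hu.integrableOn_rpow hΩb hq)).2 ?_
  · filter_upwards [ae_restrict_mem hΩ.measurableSet] with x hx
    exact Real.rpow_nonneg (hu.2.1 x hx).le _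
  · refine (hΩ.measure_pos volume hΩne).trans_le (measure_mono fun x hx => ⟨?_, hx⟩)
    exact (Real.rpow_pos_of_pos (hu.2.1 x hx) _).ne'

lemma integral_rpow_le_energy (hu : IsLeastEnergySolution N H Ω p u) (hN : 2 ≤ N)
    (hH : IsFinslerNorm N H) (hreg : FinslerRegular N H) (hΩ : IsOpen Ω)
    (hΩb : Bornology.IsBounded Ω) (hp : 0 < p) :
    ∫ x in Ω, u x ^ (p + 1) ≤ ∫ x in Ω, H (gradient u x) ^ N := by
  have key := le_apply_zero_of_eventually (c := ∫ x in Ω, u x ^ (p + 1))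
    (f := fun ε => (∫ x in Ω, H (gradient u x) ^ N) + 2 * ε * ∫ x in Ω, u x ^ p)
    (by fun_prop) ?_
  · simpa using key
  filter_upwards [self_mem_nhdsWithin] with ε hε
  rw [mem_Ioi] at hε
  obtain ⟨F, hF⟩ := exists_isProfile (lt_max_of_lt_right (lt_add_one ε) :
    ε < max (sSup (u '' Ω)) (ε + 1)) hε
  have hi := hu.integrableOn_rpow_mul hΩb hp.le hF.contDiff.continuous
  calc ∫ x in Ω, u x ^ (p + 1) ≤ ∫ x in Ω, (u x ^ p * F (u x) + 2 * ε * u x ^ p) := by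
        refine setIntegral_mono_on (hu.integrableOn_rpow hΩb (by linarith))
          (hi.add ((hu.integrableOn_rpow hΩb hp.le).const_mul _)) hΩ.measurableSet fun x hx => ?_
        have h0 := hu.2.1 x hx
        have h1 := hF.sub_le (u x) ((hu.le_sSup hΩb hx).trans (le_max_left _ _))
        rw [Real.rpow_add_one h0.ne']
        have h2 := Real.rpow_pos_of_pos h0 p
        nlinarith
    _ = (∫ x in Ω, u x ^ p * F (u x)) + 2 * ε * ∫ x in Ω, u x ^ p := by
        rw [integral_add hi ((hu.integrableOn_rpow hΩb hp.le).const_mul _), integral_const_mul]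
    _ ≤ _ := by
        linarith [hu.integral_mul_profile_le_energy hN hH hreg hΩ hΩb hp hF hε]

lemma energy_le_energyInf (hu : IsLeastEnergySolution N H Ω p u) (hN : 2 ≤ N)
    (hH : IsFinslerNorm N H) (hreg : FinslerRegular N H) (hΩ : IsOpen Ω)
    (hΩb : Bornology.IsBounded Ω) (hΩne : Ω.Nonempty) (hp : 0 < p) (hNp : (N : ℝ) < p + 1)
    (hle : energyInf N H Ω p ≤ 1) :
    ∫ x in Ω, H (gradient u x) ^ N ≤ energyInf N H Ω p := by
  have h1 := hu.integral_rpow_le_energy hN hH hreg hΩ hΩb hp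
  have h2 := hu.integral_rpow_pos hΩ hΩb hΩne (q := p + 1) (by linarith)
  have h3 := hu.2.2.2.2
  have h4 : 0 ≤ energyInf N H Ω p := energyInf_nonneg hH Ω p
  set X := ∫ x in Ω, u x ^ (p + 1)
  set E := ∫ x in Ω, H (gradient u x) ^ N
  have hθ0 : 0 ≤ (N : ℝ) / (p + 1) := by positivity
  have hθ1 : (N : ℝ) / (p + 1) < 1 := (div_lt_one (by linarith)).2 hNp
  have h5 : E ≤ energyInf N H Ω p * E ^ ((N : ℝ) / (p + 1)) := by
    conv_lhs => rw [h3]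
    gcongr
  have hE : E ≤ 1 := by
    by_contra! hlt
    have h6 : E ^ ((N : ℝ) / (p + 1)) < E ^ (1 : ℝ) := Real.rpow_lt_rpow_of_exponent_lt hlt hθ1
    rw [Real.rpow_one] at h6
    have h7 : 0 ≤ E ^ ((N : ℝ) / (p + 1)) := Real.rpow_nonneg (by linarith) _
    nlinarith
  have h6 : E ^ ((N : ℝ) / (p + 1)) ≤ 1 := Real.rpow_le_one (h2.le.trans h1) hE hθ0
  exact h5.trans (mul_le_of_le_one_right h4 h6)

/-- Isocapacitary bound for the superlevel sets of a least energy solution. -/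
lemma pow_mul_capacity_le_energy (hu : IsLeastEnergySolution N H Ω p u) (hN : 2 ≤ N)
    (hH : IsFinslerNorm N H) (hreg : FinslerRegular N H) (hΩ : IsOpen Ω)
    (hΩb : Bornology.IsBounded Ω) (hp : 0 < p) {t ρ : ℝ} (ht : 0 < t) (hρ : 0 < ρ)
    (hpos : 0 < volume.real {x | x ∈ Ω ∧ t < u x})
    (hle : ρ * volume.real Ω ≤ volume.real {x | x ∈ Ω ∧ t < u x}) :
    t ^ N * capacity H ρ ≤ ∫ x in Ω, H (gradient u x) ^ N := by
  have key := le_apply_zero_of_eventually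
    (c := -∫ x in Ω, H (gradient u x) ^ N)
    (f := fun ε => -((t - 2 * ε) ^ N * capacity H ρ)) (by fun_prop) ?_
  · simpa using key
  filter_upwards [Ioo_mem_nhdsGT (by linarith : (0 : ℝ) < t / 2)] with ε hε
  obtain ⟨F, hF⟩ := exists_isProfile (by linarith [hε.1, hε.2] : ε < t) hε.1
  have hsub : {x | x ∈ Ω ∧ t < u x} ⊆ {x | t - 2 * ε ≤ truncation Ω F u x} := fun x hx => by
    rw [Set.mem_ofPred_eq, truncation, indicator_of_mem hx.1]
    linarith [hF.sub_le t le_rfl, hF.eq_right (u x) hx.2.le]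
  have hw := hu.isCompactC1_truncation hΩ hΩb hF hε.1
  have hmono := measureReal_mono hsub
    ((measure_mono (level_subset_tsupport (by linarith [hε.2]))).trans_lt
      hw.tsupport_ne_top.lt_top).ne
  have h1 := pow_mul_le_finslerEnergy_of_level hH hρ
    (fun v hv => hv.capacity_le hH) hw (t := t - 2 * ε) (by linarith [hε.2])
    (hpos.trans_le hmono) (le_trans ?_ (hle.trans hmono))
  · have h2 := hu.finslerEnergy_truncation_le hN hH hreg hΩ hΩb hp hF hε.1
    have h3 := hu.integral_mul_profile_le_energy hN hH hreg hΩ hΩb hp hF hε.1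
    linarith
  · exact mul_le_mul_of_nonneg_left (hu.suppVol_truncation_le hΩb hF hε.1) hρ.le

lemma one_le_mul_rpow_sSup (hu : IsLeastEnergySolution N H Ω p u) (hN : 2 ≤ N)
    (hH : IsFinslerNorm N H) (hreg : FinslerRegular N H) (hΩ : IsOpen Ω)
    (hΩb : Bornology.IsBounded Ω) (hΩne : Ω.Nonempty) (hp : 0 < p) (hNp : (N : ℝ) ≤ p + 1)
    {S : ℝ} (hS0 : 0 < S) (hS : ∀ w : Euc N → ℝ, IsCompactC1 w →
      ∫ x, |w x| ^ N ≤ S * suppVol w * finslerEnergy H w) :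
    1 ≤ 2 ^ N * (S * volume.real Ω) * sSup (u '' Ω) ^ (p + 1 - N) := by
  have hN0 : (0 : ℝ) ≤ N := N.cast_nonneg
  have hfin : IsFiniteMeasure (volume.restrict Ω) := ⟨by simpa using hΩb.measure_lt_top⟩
  set X := ∫ x in Ω, u x ^ (p + 1) with hX
  have hiN : IntegrableOn (fun x => u x ^ N) Ω := hu.integrableOn_comp hΩb (continuous_pow N)
  have hXi := hu.integrableOn_rpow hΩb (q := p + 1) (by linarith)
  have h1 : ∫ x in Ω, u x ^ N ≤ 2 ^ N * (S * volume.real Ω) * X := by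
    have key := le_apply_zero_of_eventually (c := ∫ x in Ω, u x ^ N)
      (f := fun ε => 2 ^ N * (S * volume.real Ω * X + (2 * ε) ^ N * volume.real Ω))
      (by fun_prop) ?_
    · rw [mul_zero, zero_pow (by omega), zero_mul, add_zero, ← mul_assoc] at key
      exact key
    filter_upwards [self_mem_nhdsWithin] with ε hε
    rw [mem_Ioi] at hε
    obtain ⟨F, hF⟩ := exists_isProfile (lt_max_of_lt_right (lt_add_one ε) :
      ε < max (sSup (u '' Ω)) (ε + 1)) hε
    have hw := hu.isCompactC1_truncation hΩ hΩb hF hε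
    have hFi : IntegrableOn (fun x => F (u x) ^ N) Ω :=
      hu.integrableOn_comp hΩb (hF.contDiff.continuous.pow N)
    have hFw : ∫ x in Ω, F (u x) ^ N = ∫ x, |truncation Ω F u x| ^ N := by
      rw [← setIntegral_eq_of_tsupport_subset (Ω := Ω) fun x hx => ?_]
      · refine setIntegral_congr_fun hΩ.measurableSet fun x hx => ?_
        simp only [truncation, indicator_of_mem hx, abs_of_nonneg (hF.nonneg _)]
      · simp only [truncation, indicator_of_notMem hx, abs_zero, zero_pow (by omega : N ≠ 0)]
    have hen : finslerEnergy H (truncation Ω F u) ≤ X := by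
      refine (hu.finslerEnergy_truncation_le hN hH hreg hΩ hΩb hp hF hε).trans ?_
      refine setIntegral_mono_on (hu.integrableOn_rpow_mul hΩb hp.le hF.contDiff.continuous)
        hXi hΩ.measurableSet fun x hx => ?_
      have h0 := hu.2.1 x hx
      rw [Real.rpow_add_one h0.ne']
      refine mul_le_mul_of_nonneg_left ?_ (Real.rpow_nonneg h0.le _)
      rcases le_total (u x) ε with h | h
      · rw [hF.eq_zero _ h]
        exact h0.le
      · linarith [hF.le_sub h]
    calc ∫ x in Ω, u x ^ N ≤ ∫ x in Ω, 2 ^ N * (F (u x) ^ N + (2 * ε) ^ N) := by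
          refine setIntegral_mono_on hiN ((hFi.add (integrable_const _)).const_mul _)
            hΩ.measurableSet fun x hx => ?_
          have h0 := hu.2.1 x hx
          have h2 := hF.sub_le (u x) ((hu.le_sSup hΩb hx).trans (le_max_left _ _))
          have h3 := hF.nonneg (u x)
          calc u x ^ N ≤ (2 * max (F (u x)) (2 * ε)) ^ N := by
                refine pow_le_pow_left₀ h0.le ?_ _
                linarith [le_max_left (F (u x)) (2 * ε), le_max_right (F (u x)) (2 * ε)]
            _ = 2 ^ N * max (F (u x)) (2 * ε) ^ N := mul_pow _ _ _
            _ ≤ 2 ^ N * (F (u x) ^ N + (2 * ε) ^ N) := by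
                gcongr
                rcases max_cases (F (u x)) (2 * ε) with h | h <;> rw [h.1]
                · linarith [pow_nonneg (by linarith : 0 ≤ 2 * ε) N]
                · linarith [pow_nonneg h3 N]
      _ = 2 ^ N * ((∫ x, |truncation Ω F u x| ^ N) + (2 * ε) ^ N * volume.real Ω) := by
          rw [integral_const_mul, integral_add hFi (integrable_const _), hFw,
            setIntegral_const, smul_eq_mul, mul_comm (volume.real Ω)]
      _ ≤ _ := by
          gcongr
          refine (hS _ hw).trans ?_
          have := hu.suppVol_truncation_le hΩb hF hε
          have := finslerEnergy_nonneg hH (truncation Ω F u)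
          gcongr
  have h2 : X ≤ sSup (u '' Ω) ^ (p + 1 - N) * ∫ x in Ω, u x ^ N := by
    rw [← integral_const_mul]
    refine setIntegral_mono_on hXi (hiN.const_mul _) hΩ.measurableSet fun x hx => ?_
    have h0 := hu.2.1 x hx
    rw [show p + 1 = (p + 1 - N) + N by ring, Real.rpow_add h0, Real.rpow_natCast]
    simp only [add_sub_cancel_right]
    gcongr
    exact hu.le_sSup hΩb hx
  have hXpos : 0 < X := hu.integral_rpow_pos hΩ hΩb hΩne (by linarith)
  have hγ := Real.rpow_nonneg (hu.sSup_pos hΩb hΩne).le (p + 1 - N)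
  nlinarith [mul_le_mul_of_nonneg_left h1 hγ]

/-- One step of the De Giorgi–Stampacchia iteration on superlevel sets. -/
lemma level_step (hu : IsLeastEnergySolution N H Ω p u) (hN : 2 ≤ N)
    (hH : IsFinslerNorm N H) (hreg : FinslerRegular N H) (hΩ : IsOpen Ω)
    (hΩb : Bornology.IsBounded Ω) (hΩne : Ω.Nonempty) (hp : 0 < p) {b : ℕ} (hb : 1 ≤ b) {S : ℝ}
    (hS0 : 0 < S) (hS : ∀ w : Euc N → ℝ, IsCompactC1 w →
      ∫ x, |w x| ^ (N * b) ≤ S * suppVol w * finslerEnergy H w ^ b) {k s : ℝ} (hk : 0 < k)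
    (hs : 0 < s) :
    (s / 2) ^ (N * b) * volume.real {x | x ∈ Ω ∧ k + s < u x} ≤
      S * volume.real Ω *
        (sSup (u '' Ω) ^ p * s * volume.real {x | x ∈ Ω ∧ k < u x}) ^ b := by
  have hfin : IsFiniteMeasure (volume.restrict Ω) := ⟨by simpa using hΩb.measure_lt_top⟩
  have hγ := hu.sSup_pos hΩb hΩne
  obtain ⟨F, hF⟩ := exists_isProfile (by linarith : k < k + s) (half_pos hs)
  have hw := hu.isCompactC1_truncation hΩ hΩb hF hk
  have hNb : N * b ≠ 0 := by positivity
  have hen : finslerEnergy H (truncation Ω F u) ≤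
      sSup (u '' Ω) ^ p * s * volume.real {x | x ∈ Ω ∧ k < u x} := by
    refine (hu.finslerEnergy_truncation_le hN hH hreg hΩ hΩb hp hF hk).trans ?_
    have hm := (hu.isOpen_superlevel hΩ k).measurableSet
    have hsub : {x | x ∈ Ω ∧ k < u x} ⊆ Ω := fun x hx => hx.1
    calc ∫ x in Ω, u x ^ p * F (u x)
        ≤ ∫ x in Ω, {x | x ∈ Ω ∧ k < u x}.indicator (fun _ => sSup (u '' Ω) ^ p * s) x := by
          refine setIntegral_mono_on (hu.integrableOn_rpow_mul hΩb hp.le hF.contDiff.continuous)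
            ((integrable_const _).indicator hm) hΩ.measurableSet fun x hx => ?_
          have h0 := hu.2.1 x hx
          by_cases h : k < u x
          · rw [indicator_of_mem (show x ∈ {x | x ∈ Ω ∧ k < u x} from ⟨hx, h⟩)]
            have h1 : F (u x) ≤ s := by
              rcases le_total (u x) (k + s) with h2 | h2
              · linarith [hF.le_sub h.le]
              · rw [hF.eq_right _ h2]
                linarith [hF.le_sub (by linarith : k ≤ k + s)]
            have := hu.le_sSup hΩb hx
            have := hF.nonneg (u x)
            gcongr
          · rw [indicator_of_notMem fun h' => h h'.2, hF.eq_zero _ (not_lt.1 h), mul_zero]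
      _ = _ := by
          rw [setIntegral_indicator hm, inter_eq_right.2 hsub, setIntegral_const, smul_eq_mul,
            mul_comm]
  have hint : Integrable fun x => |truncation Ω F u x| ^ (N * b) := by
    refine Continuous.integrable_of_hasCompactSupport (hw.continuous.abs.pow _) ?_
    exact hw.hasCompactSupport.comp_left (g := fun r => |r| ^ (N * b)) (by simp [hNb])
  have hcheb := mul_meas_ge_le_integral_of_nonneg
    (Eventually.of_forall fun x => pow_nonneg (abs_nonneg (truncation Ω F u x)) (N * b)) hint
    ((s / 2) ^ (N * b))
  have hlev : volume.real {x | x ∈ Ω ∧ k + s < u x} ≤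
      volume.real {x | (s / 2) ^ (N * b) ≤ |truncation Ω F u x| ^ (N * b)} := by
    refine measureReal_mono (fun x hx => ?_) (ne_top_of_le_ne_top hw.tsupport_ne_top
      (measure_mono fun x hx => subset_tsupport _ fun h0 => ?_))
    · rw [Set.mem_ofPred_eq, truncation, indicator_of_mem hx.1, hF.eq_right _ hx.2.le]
      gcongr
      exact le_trans (by linarith [hF.sub_le (k + s) le_rfl]) (le_abs_self _)
    · rw [Set.mem_ofPred_eq, h0, abs_zero, zero_pow hNb] at hx
      exact absurd hx (not_le.2 (by positivity))
  calc (s / 2) ^ (N * b) * volume.real {x | x ∈ Ω ∧ k + s < u x}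
      ≤ ∫ x, |truncation Ω F u x| ^ (N * b) :=
        (mul_le_mul_of_nonneg_left hlev (by positivity)).trans hcheb
    _ ≤ S * suppVol (truncation Ω F u) * finslerEnergy H (truncation Ω F u) ^ b := hS _ hw
    _ ≤ _ := by
        have := hu.suppVol_truncation_le hΩb hF hk
        have := finslerEnergy_nonneg hH (truncation Ω F u)
        gcongr

/-- The superlevel set just below the maximum of a least energy solution is not too small. -/
lemma one_le_mul_level (hu : IsLeastEnergySolution N H Ω p u) (hN : 2 ≤ N)
    (hH : IsFinslerNorm N H) (hreg : FinslerRegular N H) (hΩ : IsOpen Ω)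
    (hΩb : Bornology.IsBounded Ω) (hΩne : Ω.Nonempty) (hp : 0 < p) {n : ℕ} (hn : 1 ≤ n) {S : ℝ}
    (hS0 : 0 < S) (hS : ∀ w : Euc N → ℝ, IsCompactC1 w →
      ∫ x, |w x| ^ (N * (n + 1)) ≤ S * suppVol w * finslerEnergy H w ^ (n + 1)) {d : ℝ}
    (hd : 0 < d) (hdγ : 2 * d < sSup (u '' Ω)) :
    1 ≤ S * volume.real Ω * d ^ (n + 1) * (4 / d) ^ (N * (n + 1)) * 2 ^ (N * (n + 1)) *
        (sSup (u '' Ω) ^ p) ^ (n + 1) *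
        volume.real {x | x ∈ Ω ∧ sSup (u '' Ω) - 2 * d < u x} ^ n := by
  have hγ := hu.sSup_pos hΩb hΩne
  set γ := sSup (u '' Ω) with hγdef
  have hvΩ : 0 < volume.real Ω :=
    ENNReal.toReal_pos (hΩ.measure_pos volume hΩne).ne' hΩb.measure_lt_top.ne
  have hfinite (t : ℝ) : volume {x | x ∈ Ω ∧ t < u x} ≠ ⊤ :=
    ne_top_of_le_ne_top hΩb.measure_lt_top.ne (measure_mono fun x hx => hx.1)
  have hm : 0 < volume.real {x | x ∈ Ω ∧ γ - d < u x} := by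
    refine ENNReal.toReal_pos ((hu.isOpen_superlevel hΩ _).measure_pos volume ?_).ne' (hfinite _)
    obtain ⟨_, ⟨x, hx, rfl⟩, h⟩ := exists_lt_of_lt_csSup (hΩne.image u)
      (by linarith : γ - d < sSup (u '' Ω))
    exact ⟨x, hx, h⟩
  have key := one_le_of_superlinear (n := n)
    (Y := fun j : ℕ => volume.real {x | x ∈ Ω ∧ γ - d - d / 2 ^ j < u x})
    (C := S * volume.real Ω * d ^ (n + 1) * (4 / d) ^ (N * (n + 1)) * (γ ^ p) ^ (n + 1))
    (M := 2 ^ (N * (n + 1))) hn (one_le_pow₀ one_le_two) (by positivity) hm (fun j => ?_)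
    (fun j => ?_)
  · refine key.trans (le_of_eq ?_)
    simp only [pow_zero, div_one]
    rw [show γ - d - d = γ - 2 * d by ring]
    ring
  · refine measureReal_mono (fun x hx => ⟨hx.1, lt_of_le_of_lt ?_ hx.2⟩) (hfinite _)
    have : 0 < d / 2 ^ j := by positivity
    linarith
  · have hj : d / 2 ^ j ≤ d := div_le_self hd.le (one_le_pow₀ one_le_two)
    have h1 := hu.level_step hN hH hreg hΩ hΩb hΩne hp (by omega : 1 ≤ n + 1) hS0 hS
      (k := γ - d - d / 2 ^ j) (s := d / 2 ^ (j + 1)) (by linarith) (by positivity)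
    rw [show γ - d - d / 2 ^ j + d / 2 ^ (j + 1) = γ - d - d / 2 ^ (j + 1) by
      rw [pow_succ]; field_simp; ring] at h1
    rw [← hγdef] at h1
    set A := volume.real {x | x ∈ Ω ∧ γ - d - d / 2 ^ j < u x}
    set B := volume.real {x | x ∈ Ω ∧ γ - d - d / 2 ^ (j + 1) < u x}
    have hA : 0 ≤ A := measureReal_nonneg
    have hs : d / 2 ^ (j + 1) ≤ d := div_le_self hd.le (one_le_pow₀ one_le_two)
    have h2 : (4 / d * 2 ^ j) ^ (N * (n + 1)) * (d / 2 ^ (j + 1) / 2) ^ (N * (n + 1)) = 1 := by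
      rw [← mul_pow, show 4 / d * 2 ^ j * (d / 2 ^ (j + 1) / 2) = 1 by
        rw [pow_succ]; field_simp; norm_num, one_pow]
    calc B = (4 / d * 2 ^ j) ^ (N * (n + 1)) * ((d / 2 ^ (j + 1) / 2) ^ (N * (n + 1)) * B) := by
          rw [← mul_assoc, h2, one_mul]
      _ ≤ (4 / d * 2 ^ j) ^ (N * (n + 1)) *
          (S * volume.real Ω * (γ ^ p * d * A) ^ (n + 1)) := by
          refine mul_le_mul_of_nonneg_left (h1.trans ?_) (by positivity)
          gcongr
      _ = _ := by ring

end IsLeastEnergySolution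

end Solution

/-! ### Asymptotics as `p → ∞` -/

lemma tendsto_rpow_div_add_one (A c : ℝ) (hA : 0 < A) :
    Tendsto (fun p : ℝ => A ^ (c / (p + 1))) atTop (𝓝 1) := by
  have h : Tendsto (fun p : ℝ => c / (p + 1)) atTop (𝓝 0) :=
    tendsto_const_nhds.div_atTop (tendsto_atTop_add_const_right _ _ tendsto_id)
  have h1 := (Real.continuousAt_const_rpow (b := 0) hA.ne').tendsto.comp h
  rw [Real.rpow_zero] at h1
  exact h1

section Asymptotics

variable {N : ℕ} {H : Euc N → ℝ} {Ω : Set (Euc N)} {ℓ : ℝ}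

lemma energyInf_mul_exp_le_capacity (hN : 2 ≤ N) (hH : IsFinslerNorm N H) {ε A p L : ℝ}
    (hε : 0 < ε) (hA : 0 < A) (hp : 0 < p) (hL : 0 < L) (hLp : L * (N / (p + 1)) ≤ (N : ℝ) - 1)
    (h : ∀ w, IsCompactC1 w → 0 < suppVol w →
      energyInf N H Ω p * (A * (∫ x, |w x| ^ (p + 1)) / suppVol w) ^ ((N : ℝ) / (p + 1))
        ≤ (1 + ε) * finslerEnergy H w) :
    energyInf N H Ω p * (A ^ ((N : ℝ) / (p + 1)) * Real.exp (-((N : ℝ) - 1)))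
      ≤ (1 + ε) * capacity H (Real.exp (-L)) := by
  have hC : 0 ≤ energyInf N H Ω p := energyInf_nonneg hH Ω p
  rw [← div_le_iff₀' (by linarith)]
  refine le_capacity (by omega) (Real.exp_pos _) (Real.exp_lt_one_iff.2 (by linarith)) fun w hw => ?_
  rw [div_le_iff₀' (by linarith)]
  refine le_trans ?_ (h w hw.isCompactC1 hw.suppVol_pos)
  have hV := hw.suppVol_pos
  have hcheb := mul_meas_ge_le_integral_of_nonneg
    (Eventually.of_forall fun x => Real.rpow_nonneg (abs_nonneg (w x)) (p + 1))
    (hw.isCompactC1.integrable_rpow (by linarith : 0 < p + 1)) 1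
  have hlev : volume.real {x | 1 ≤ w x} ≤ volume.real {x | 1 ≤ |w x| ^ (p + 1)} := by
    refine measureReal_mono (fun x hx => Real.one_le_rpow (le_trans hx (le_abs_self _))
      (by linarith)) (ne_top_of_le_ne_top hw.isCompactC1.tsupport_ne_top
      (measure_mono fun x hx => subset_tsupport _ fun h0 => ?_))
    rw [Set.mem_ofPred_eq, h0, abs_zero, Real.zero_rpow (by linarith)] at hx
    linarith
  have h1 : Real.exp (-L) * suppVol w ≤ ∫ x, |w x| ^ (p + 1) := by
    linarith [hw.le_level]
  have hρ : A * Real.exp (-L) ≤ A * (∫ x, |w x| ^ (p + 1)) / suppVol w := by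
    rw [le_div_iff₀ hV, mul_assoc]
    gcongr
  calc energyInf N H Ω p * (A ^ ((N : ℝ) / (p + 1)) * Real.exp (-((N : ℝ) - 1)))
      ≤ energyInf N H Ω p * (A * Real.exp (-L)) ^ ((N : ℝ) / (p + 1)) := by
        rw [Real.mul_rpow hA.le (Real.exp_pos _).le, ← Real.exp_mul]
        gcongr
        linarith
    _ ≤ _ := by gcongr

lemma eventually_energyInf_mul_le (hN : 2 ≤ N) (hH : IsFinslerNorm N H) (hΩ : IsOpen Ω)
    (hΩb : Bornology.IsBounded Ω) (hΩne : Ω.Nonempty) (hℓ : 0 < ℓ)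
    (hlim : Tendsto (fun L => capacity H (Real.exp (-L)) * (ℓ * L) ^ (N - 1)) atTop (𝓝 1))
    {κ : ℝ} (hκ : 1 < κ) :
    ∀ᶠ p : ℝ in atTop, energyInf N H Ω p * (ℓ * (((N : ℝ) - 1) / N * p)) ^ (N - 1)
      ≤ κ * Real.exp ((N : ℝ) - 1) := by
  have hN2 : (2 : ℝ) ≤ N := by exact_mod_cast hN
  have hc : 0 < ((N : ℝ) - 1) / N := div_pos (by linarith) (by linarith)
  obtain ⟨A, hA, hloc⟩ := exists_localization hN hH hΩ hΩb hΩne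
    (by linarith : 0 < (κ - 1) / 2)
  have hlim' := hlim.comp (tendsto_id.const_mul_atTop hc)
  have h1 := (((hlim'.const_mul (1 + (κ - 1) / 2)).mul_const (Real.exp ((N : ℝ) - 1))).div
    (tendsto_rpow_div_add_one A N hA) one_ne_zero).eventually_lt_const
    (u := κ * Real.exp ((N : ℝ) - 1)) (by
      rw [mul_one, div_one]
      have := Real.exp_pos ((N : ℝ) - 1)
      gcongr
      linarith)
  filter_upwards [h1, eventually_ge_atTop (N : ℝ)] with p h1 hp
  refine le_trans ?_ h1.le
  have hp0 : 0 < p := by linarith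
  simp only [Pi.div_apply, Function.comp_apply, id]
  set L := ((N : ℝ) - 1) / N * p with hLdef
  have hL : 0 < L := mul_pos hc hp0
  have h2 := energyInf_mul_exp_le_capacity hN hH (by linarith : 0 < (κ - 1) / 2) hA hp0 hL ?_
    (hloc p hp0 (by linarith))
  · have hA' : 0 < A ^ ((N : ℝ) / (p + 1)) := Real.rpow_pos_of_pos hA _
    have hE := Real.exp_pos ((N : ℝ) - 1)
    rw [Real.exp_neg] at h2
    rw [le_div_iff₀ hA']
    calc energyInf N H Ω p * (ℓ * L) ^ (N - 1) * A ^ ((N : ℝ) / (p + 1))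
        = energyInf N H Ω p * (A ^ ((N : ℝ) / (p + 1)) * (Real.exp ((N : ℝ) - 1))⁻¹) *
          ((ℓ * L) ^ (N - 1) * Real.exp ((N : ℝ) - 1)) := by field_simp
      _ ≤ (1 + (κ - 1) / 2) * capacity H (Real.exp (-L)) *
          ((ℓ * L) ^ (N - 1) * Real.exp ((N : ℝ) - 1)) := by gcongr
      _ = _ := by ring
  · rw [hLdef, show ((N : ℝ) - 1) / N * p * (N / (p + 1)) = (N - 1) * (p / (p + 1)) by
      field_simp]
    exact mul_le_of_le_one_right (by linarith) ((div_le_one (by linarith)).2 (by linarith))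

lemma eventually_energyInf_le_one (hN : 2 ≤ N) (hH : IsFinslerNorm N H) (hΩ : IsOpen Ω)
    (hΩb : Bornology.IsBounded Ω) (hΩne : Ω.Nonempty) :
    ∀ᶠ p : ℝ in atTop, energyInf N H Ω p ≤ 1 := by
  have hN2 : (2 : ℝ) ≤ N := by exact_mod_cast hN
  have hc : 0 < ((N : ℝ) - 1) / N := div_pos (by linarith) (by linarith)
  obtain ⟨ℓ, hℓ, hlim⟩ := exists_tendsto_capacity hN hH
  have h1 : Tendsto (fun p : ℝ => (ℓ * (((N : ℝ) - 1) / N * p)) ^ (N - 1)) atTop atTop :=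
    (tendsto_pow_atTop (by omega)).comp
      ((tendsto_id.const_mul_atTop hc).const_mul_atTop hℓ)
  filter_upwards [eventually_energyInf_mul_le hN hH hΩ hΩb hΩne hℓ hlim one_lt_two,
    h1.eventually_ge_atTop (2 * Real.exp ((N : ℝ) - 1))] with p h2 h3
  have := Real.exp_pos ((N : ℝ) - 1)
  refine le_of_mul_le_mul_right ?_ (by linarith :
    0 < (ℓ * (((N : ℝ) - 1) / N * p)) ^ (N - 1))
  linarith

/-- If the maximum exceeds `Γ > 1`, then the superlevel set near the maximum occupies at least the
fraction `γ ^ (-σ p)` of the domain. -/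
lemma eventually_exp_mul_volume_le_level (hN : 2 ≤ N) (hH : IsFinslerNorm N H)
    (hreg : FinslerRegular N H) (hΩ : IsOpen Ω) (hΩb : Bornology.IsBounded Ω)
    (hΩne : Ω.Nonempty) {σ d Γ : ℝ} (hσ : 1 < σ) (hd : 0 < d) (hdΓ : 2 * d < Γ) (hΓ : 1 < Γ) :
    ∀ᶠ p : ℝ in atTop, ∀ u, IsLeastEnergySolution N H Ω p u → Γ ≤ sSup (u '' Ω) →
      Real.exp (-(σ * p * Real.log (sSup (u '' Ω)))) * volume.real Ω ≤
        volume.real {x | x ∈ Ω ∧ sSup (u '' Ω) - 2 * d < u x} := by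
  have hvΩ : 0 < volume.real Ω :=
    ENNReal.toReal_pos (hΩ.measure_pos volume hΩne).ne' hΩb.measure_lt_top.ne
  obtain ⟨n, hn⟩ := exists_nat_gt (1 / (σ - 1))
  have hn0 : (0 : ℝ) < n := (one_div_pos.2 (by linarith)).trans hn
  have hn1 : 1 ≤ n := by exact_mod_cast hn0
  have hη : 0 < n * σ - (n + 1) := by
    rw [div_lt_iff₀ (by linarith)] at hn
    linarith
  obtain ⟨S, hS0, hS⟩ := exists_sobolev hN hH (by omega : 1 ≤ n + 1)
  obtain ⟨K, hK, hK0⟩ : ∃ K, K = S * volume.real Ω * d ^ (n + 1) * (4 / d) ^ (N * (n + 1)) *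
      2 ^ (N * (n + 1)) ∧ 0 < K := ⟨_, rfl, by positivity⟩
  have hΓ0 := Real.log_pos hΓ
  have hlim : Tendsto (fun p : ℝ => K * volume.real Ω ^ n *
      Real.exp (-((n * σ - (n + 1)) * Real.log Γ * p))) atTop (𝓝 0) := by
    have h := (Real.tendsto_exp_neg_atTop_nhds_zero.comp
      (tendsto_id.const_mul_atTop (mul_pos hη hΓ0))).const_mul (K * volume.real Ω ^ n)
    rw [mul_zero] at h
    exact h
  filter_upwards [hlim.eventually_lt_const one_pos, eventually_gt_atTop 0] with p h1 hp u hu hγ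
  have h2 := hu.one_le_mul_level hN hH hreg hΩ hΩb hΩne hp hn1 hS0 hS hd (hdΓ.trans_le hγ)
  rw [← hK] at h2
  set γ := sSup (u '' Ω)
  set A := volume.real {x | x ∈ Ω ∧ γ - 2 * d < u x}
  by_contra! hlt
  have hA : 0 ≤ A := measureReal_nonneg
  have hγ0 : 0 < γ := by linarith
  have hlog : Real.log Γ ≤ Real.log γ := Real.log_le_log (by linarith) hγ
  have h3 : (γ ^ p) ^ (n + 1) = Real.exp ((n + 1) * p * Real.log γ) := by
    rw [Real.rpow_def_of_pos hγ0, ← Real.exp_nat_mul]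
    push_cast
    ring_nf
  have h4 : A ^ n ≤ Real.exp (-(n * σ * p * Real.log γ)) * volume.real Ω ^ n := by
    calc A ^ n ≤ (Real.exp (-(σ * p * Real.log γ)) * volume.real Ω) ^ n := by gcongr
      _ = _ := by rw [mul_pow, ← Real.exp_nat_mul]; ring_nf
  have h5 : 1 ≤ K * volume.real Ω ^ n * Real.exp (-((n * σ - (n + 1)) * Real.log Γ * p)) := by
    calc 1 ≤ K * (γ ^ p) ^ (n + 1) * A ^ n := h2
      _ ≤ K * Real.exp ((n + 1) * p * Real.log γ) *
          (Real.exp (-(n * σ * p * Real.log γ)) * volume.real Ω ^ n) := by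
          rw [h3]
          gcongr
      _ = K * volume.real Ω ^ n * Real.exp (-((n * σ - (n + 1)) * Real.log γ * p)) := by
          rw [show -((n * σ - (n + 1)) * Real.log γ * p)
            = (n + 1) * p * Real.log γ + -(n * σ * p * Real.log γ) by ring, Real.exp_add]
          ring
      _ ≤ _ := by gcongr
  linarith

lemma mul_le_exp_sub_one {δ y : ℝ} (hδ : 0 < δ) (hy : 1 + δ ≤ y) :
    Real.exp δ / (1 + δ) * y ≤ Real.exp (y - 1) := by
  have h1 := Real.add_one_le_exp (y - 1 - δ)
  have h2 : y / (1 + δ) ≤ y - δ := by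
    rw [div_le_iff₀ (by linarith)]
    nlinarith
  calc Real.exp δ / (1 + δ) * y = Real.exp δ * (y / (1 + δ)) := by ring
    _ ≤ Real.exp δ * Real.exp (y - 1 - δ) := by
        gcongr
        linarith
    _ = Real.exp (y - 1) := by rw [← Real.exp_add]; ring_nf

lemma exists_one_lt_pow_lt {q : ℝ} (hq : 1 < q) (m : ℕ) : ∃ σ : ℝ, 1 < σ ∧ σ ^ m < q := by
  have h : Tendsto (fun σ : ℝ => σ ^ m) (𝓝[>] 1) (𝓝 1) := by
    simpa using ((continuous_pow m).tendsto (1 : ℝ)).mono_left nhdsWithin_le_nhds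
  obtain ⟨σ, h1, h2⟩ := ((h.eventually_lt_const hq).and self_mem_nhdsWithin).exists
  exact ⟨σ, h2, h1⟩

lemma eventually_sSup_le (hN : 2 ≤ N) (hH : IsFinslerNorm N H) (hreg : FinslerRegular N H)
    (hΩ : IsOpen Ω) (hΩb : Bornology.IsBounded Ω) (hΩne : Ω.Nonempty) {δ : ℝ} (hδ : 0 < δ) :
    ∀ᶠ p : ℝ in atTop, ∀ u, IsLeastEnergySolution N H Ω p u →
      sSup (u '' Ω) ≤ Real.exp (((N : ℝ) - 1) / N * (1 + δ)) := by
  have hN2 : (2 : ℝ) ≤ N := by exact_mod_cast hN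
  have hc : 0 < ((N : ℝ) - 1) / N := div_pos (by linarith) (by linarith)
  have hvΩ : 0 < volume.real Ω :=
    ENNReal.toReal_pos (hΩ.measure_pos volume hΩne).ne' hΩb.measure_lt_top.ne
  obtain ⟨ℓ, hℓ, hlim⟩ := exists_tendsto_capacity hN hH
  have hq : 1 < Real.exp δ / (1 + δ) := by
    rw [one_lt_div (by linarith)]
    linarith [Real.add_one_lt_exp hδ.ne']
  obtain ⟨σ, hσ, hσq⟩ := exists_one_lt_pow_lt
    (one_lt_pow₀ hq (by omega : N - 1 ≠ 0)) (N + 1 + N)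
  have hσ0 : 0 < σ := by linarith
  set Γ := Real.exp (((N : ℝ) - 1) / N * (1 + δ)) with hΓdef
  have hΓ : 1 < Γ := Real.one_lt_exp_iff.2 (by positivity)
  have hlogΓ : Real.log Γ = ((N : ℝ) - 1) / N * (1 + δ) := Real.log_exp _
  have hσinv : σ⁻¹ < 1 := inv_lt_one_of_one_lt₀ hσ
  have hσinv0 : 0 < σ⁻¹ := inv_pos.2 hσ0
  obtain ⟨L₀, hL₀⟩ := eventually_atTop.1 (hlim.eventually_const_lt hσinv)
  filter_upwards [eventually_exp_mul_volume_le_level hN hH hreg hΩ hΩb hΩne hσ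
      (by linarith : 0 < (1 - σ⁻¹) / 2) (by linarith) hΓ,
    eventually_energyInf_le_one hN hH hΩ hΩb hΩne,
    eventually_energyInf_mul_le hN hH hΩ hΩb hΩne hℓ hlim hσ,
    eventually_ge_atTop (N : ℝ), eventually_ge_atTop (L₀ / Real.log Γ)]
    with p hlevel hone henergy hpN hpL u hu
  by_contra! hlt
  have hp : 0 < p := by linarith
  have hlev := hlevel u hu hlt.le
  set γ := sSup (u '' Ω)
  have hγ0 : 0 < γ := by linarith
  have hlogΓ0 : 0 < Real.log Γ := Real.log_pos hΓ
  have hlogγ : Real.log Γ ≤ Real.log γ := Real.log_le_log (by linarith) hlt.le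
  have hlogγ0 : 0 < Real.log γ := hlogΓ0.trans_le hlogγ
  have ht : σ⁻¹ * γ ≤ γ - 2 * ((1 - σ⁻¹) / 2) := by nlinarith
  have hcap := hu.pow_mul_capacity_le_energy hN hH hreg hΩ hΩb hp
    ((mul_pos hσinv0 hγ0).trans_le ht) (Real.exp_pos _)
    (lt_of_lt_of_le (by positivity) hlev) hlev
  have hEC := hu.energy_le_energyInf hN hH hreg hΩ hΩb hΩne hp (by linarith) hone
  obtain ⟨y, hy⟩ : ∃ y, Real.log γ = ((N : ℝ) - 1) / N * y :=
    ⟨Real.log γ / (((N : ℝ) - 1) / N), (mul_div_cancel₀ _ hc.ne').symm⟩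
  have hy1 : 1 + δ ≤ y := by
    rw [hy, hlogΓ] at hlogγ
    exact le_of_mul_le_mul_left hlogγ hc
  have hL := hL₀ (σ * p * Real.log γ) (by
    rw [div_le_iff₀ hlogΓ0] at hpL
    calc L₀ ≤ p * Real.log Γ := hpL
      _ ≤ p * Real.log γ := by gcongr
      _ ≤ σ * (p * Real.log γ) := le_mul_of_one_le_left (by positivity) hσ.le
      _ = σ * p * Real.log γ := by ring)
  set c := capacity H (Real.exp (-(σ * p * Real.log γ)))
  have hc0 : 0 < c := capacity_pos hN hH (Real.exp_pos _)
    (Real.exp_lt_one_iff.2 (neg_neg_of_pos (by positivity)))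
  have hy0 : 0 < y := by linarith
  have hγN : γ ^ N = Real.exp ((N : ℝ) - 1) * Real.exp (y - 1) ^ (N - 1) := by
    rw [← Real.exp_log hγ0, ← Real.exp_nat_mul, ← Real.exp_nat_mul, ← Real.exp_add, hy,
      Nat.cast_sub (by omega), Nat.cast_one]
    congr 1
    field_simp
    ring
  have main : σ⁻¹ ^ N * γ ^ N * σ⁻¹ ≤ σ * Real.exp ((N : ℝ) - 1) * (σ * y) ^ (N - 1) := by
    calc σ⁻¹ ^ N * γ ^ N * σ⁻¹
        ≤ σ⁻¹ ^ N * γ ^ N * (c * (ℓ * (σ * p * Real.log γ)) ^ (N - 1)) := by gcongr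
      _ = (σ⁻¹ * γ) ^ N * c * (ℓ * (σ * p * Real.log γ)) ^ (N - 1) := by ring
      _ ≤ (γ - 2 * ((1 - σ⁻¹) / 2)) ^ N * c * (ℓ * (σ * p * Real.log γ)) ^ (N - 1) := by
          gcongr
      _ ≤ energyInf N H Ω p * (ℓ * (σ * p * Real.log γ)) ^ (N - 1) := by
          gcongr
          exact hcap.trans hEC
      _ = energyInf N H Ω p * (ℓ * (((N : ℝ) - 1) / N * p)) ^ (N - 1) * (σ * y) ^ (N - 1) := by
          rw [mul_assoc (energyInf N H Ω p), ← mul_pow, hy]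
          ring_nf
      _ ≤ _ := by gcongr
  have hle : Real.exp (y - 1) ^ (N - 1) ≤ σ ^ (N + 1 + N) * y ^ (N - 1) := by
    rw [hγN] at main
    have h1 : σ ^ (N + 1) * (σ⁻¹ ^ N * (Real.exp ((N : ℝ) - 1) * Real.exp (y - 1) ^ (N - 1)) *
        σ⁻¹) = Real.exp ((N : ℝ) - 1) * Real.exp (y - 1) ^ (N - 1) := by
      rw [pow_succ, inv_pow]
      field_simp
    have h2 : σ ^ (N + 1) * (σ * Real.exp ((N : ℝ) - 1) * (σ * y) ^ (N - 1))
        = Real.exp ((N : ℝ) - 1) * (σ ^ (N + 1 + N) * y ^ (N - 1)) := by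
      obtain ⟨k, rfl⟩ := Nat.exists_eq_add_of_le' (by omega : 1 ≤ N)
      rw [Nat.add_sub_cancel]
      ring
    have h3 := mul_le_mul_of_nonneg_left main (pow_nonneg hσ0.le (N + 1))
    rw [h1, h2] at h3
    exact le_of_mul_le_mul_left h3 (Real.exp_pos _)
  have hge : (Real.exp δ / (1 + δ)) ^ (N - 1) * y ^ (N - 1) ≤ Real.exp (y - 1) ^ (N - 1) := by
    rw [← mul_pow]
    have := mul_le_exp_sub_one hδ hy1
    gcongr
  have hfin := mul_lt_mul_of_pos_right hσq (pow_pos hy0 (N - 1))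
  linarith

lemma eventually_le_sSup (hN : 2 ≤ N) (hH : IsFinslerNorm N H) (hreg : FinslerRegular N H)
    (hΩ : IsOpen Ω) (hΩb : Bornology.IsBounded Ω) (hΩne : Ω.Nonempty) {a : ℝ} (ha0 : 0 < a)
    (ha : a < 1) :
    ∀ᶠ p : ℝ in atTop, ∀ u, IsLeastEnergySolution N H Ω p u → a ≤ sSup (u '' Ω) := by
  obtain ⟨S, hS0, hS⟩ := exists_sobolev hN hH le_rfl
  simp only [mul_one, pow_one] at hS
  have hlim : Tendsto (fun p : ℝ => 2 ^ N * (S * volume.real Ω) * a ^ (p + 1 - N)) atTop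
      (𝓝 0) := by
    have h := ((tendsto_rpow_atTop_of_base_lt_one a (by linarith) ha).comp
      (tendsto_atTop_add_const_right atTop (1 - (N : ℝ)) tendsto_id)).const_mul
      (2 ^ N * (S * volume.real Ω))
    rw [mul_zero] at h
    refine h.congr fun p => ?_
    simp only [Function.comp_apply, id, add_sub_assoc]
  filter_upwards [hlim.eventually_lt_const one_pos, eventually_ge_atTop (N : ℝ),
    eventually_gt_atTop 0] with p h1 hpN hp u hu
  have h2 := hu.one_le_mul_rpow_sSup hN hH hreg hΩ hΩb hΩne hp (by linarith) hS0 hS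
  by_contra! hlt
  have h3 : sSup (u '' Ω) ^ (p + 1 - N) ≤ a ^ (p + 1 - N) :=
    Real.rpow_le_rpow (hu.sSup_pos hΩb hΩne).le hlt.le (by linarith)
  have h4 := mul_le_mul_of_nonneg_left h3
    (by positivity : 0 ≤ 2 ^ N * (S * volume.real Ω))
  linarith

end Asymptotics

/-- Bounds on the limsup of the `L^∞` norms (Theorem 1.2). -/
theorem limsup_linfty (N : ℕ) (hN : 2 ≤ N) (H : Euc N → ℝ)
    (hnorm : IsFinslerNorm N H) (hreg : FinslerRegular N H)
    (Ω : Set (Euc N)) (hΩo : IsOpen Ω) (hΩb : Bornology.IsBounded Ω) (hΩne : Ω.Nonempty)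
    (u : ℝ → Euc N → ℝ) (hu : ∀ p > 1, IsLeastEnergySolution N H Ω p (u p)) :
    1 ≤ Filter.limsup (fun p : ℝ => sSup (u p '' Ω)) atTop ∧
    Filter.limsup (fun p : ℝ => sSup (u p '' Ω)) atTop
      ≤ Real.exp (((N : ℝ) - 1) / N) := by
  have hupper {δ : ℝ} (hδ : 0 < δ) :
      ∀ᶠ p in atTop, sSup (u p '' Ω) ≤ Real.exp (((N : ℝ) - 1) / N * (1 + δ)) := by
    filter_upwards [eventually_sSup_le hN hnorm hreg hΩo hΩb hΩne hδ, eventually_gt_atTop 1]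
      with p h hp using h _ (hu p hp)
  have hlower {δ : ℝ} (hδ : 0 < δ) (hδ1 : δ < 1) :
      ∀ᶠ p in atTop, 1 - δ ≤ sSup (u p '' Ω) := by
    filter_upwards [eventually_le_sSup hN hnorm hreg hΩo hΩb hΩne (by linarith : 0 < 1 - δ)
      (by linarith), eventually_gt_atTop 1] with p h hp using h _ (hu p hp)
  have hb : IsBoundedUnder (· ≤ ·) atTop fun p : ℝ => sSup (u p '' Ω) :=
    isBoundedUnder_of_eventually_le (hupper one_pos)
  have hcob : IsCoboundedUnder (· ≤ ·) atTop fun p : ℝ => sSup (u p '' Ω) :=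
    (isBoundedUnder_of_eventually_ge (hlower one_half_pos one_half_lt_one)).isCoboundedUnder_le
  constructor
  · refine le_of_forall_pos_lt_add fun δ hδ => ?_
    have hm : 0 < min δ 1 / 2 := by positivity
    have h := le_limsup_of_frequently_le
      (hlower hm (by linarith [min_le_right δ 1])).frequently hb
    linarith [min_le_left δ 1]
  · have key := le_apply_zero_of_eventually
      (c := Filter.limsup (fun p : ℝ => sSup (u p '' Ω)) atTop)
      (f := fun δ => Real.exp (((N : ℝ) - 1) / N * (1 + δ))) (by fun_prop) (by
        filter_upwards [self_mem_nhdsWithin] with δ hδ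
        exact limsup_le_of_le hcob (hupper hδ))
    simpa using key
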